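/- arXiv:1403.5749 — 8 statements merged into one kernel-verified Lean document; each statement's English description precedes it below -/
import Mathlib

section
/- (Multivariate Faà di Bruno formula.) Let d ≥ 1, let h : ℝ^d → ℝ be a scalar function which is C^∞ in a neighborhood of y₀ = g(x₀), and let g : ℝ → ℝ^d be a vector function which is C^∞ in a neighborhood of x₀ ∈ ℝ. Define f(x) = h(g(x)). Then for any n ≥ 1, f^{(n)}(x₀) = n! · Σ_{1 ≤ |α| ≤ n} (∂^α h)(g(x₀)) · Σ_{s=1}^n Σ_{(k_1,…,k_s; ℓ_1,…,ℓ_s) ∈ P_s(n,α)} ∏_{j=1}^s ( ((d/dx)^{ℓ_j} g)(x₀) )^{k_j} / ( (k_j!) · (ℓ_j!)^{|k_j|} ), with the convention 0^0 := 1. Here for a vector y ∈ ℝ^d and a multi-index k ∈ ℕ₀^d, y^k denotes ∏_{i=1}^d y_i^{k_i}. -/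
/-- The partial derivative `∂_{x_i}` of a scalar function on `ℝ^d`. -/
noncomputable def partialDeriv {d : ℕ} (i : Fin d) (f : (Fin d → ℝ) → ℝ) :
    (Fin d → ℝ) → ℝ :=
  fun x => deriv (fun t => f (Function.update x i t)) (x i)

/-- The iterated partial derivative `∂^α = ∂_{x_1}^{α_1} ⋯ ∂_{x_d}^{α_d}` of a scalar
function on `ℝ^d`, for a multi-index `α ∈ ℕ₀^d`. -/
noncomputable def partialDerivMulti {d : ℕ} (α : Fin d → ℕ) (f : (Fin d → ℝ) → ℝ) :
    (Fin d → ℝ) → ℝ :=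
  (List.finRange d).foldr (fun i g => (partialDeriv i)^[α i] g) f

/-- The index set `P_s(n, α)`: tuples `(k_1, …, k_s; ℓ_1, …, ℓ_s)` with `k_i ∈ ℕ₀^d`,
`|k_i| > 0`, `0 < ℓ_1 < ⋯ < ℓ_s`, `∑ k_i = α` and `∑ |k_i| ℓ_i = n`. -/
def Ps (d n s : ℕ) (α : Fin d → ℕ) : Set ((Fin s → Fin d → ℕ) × (Fin s → ℕ)) :=
  {p | (∀ i, 0 < ∑ j, p.1 i j) ∧ (∀ i, 0 < p.2 i) ∧ StrictMono p.2 ∧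
       (∀ j, ∑ i, p.1 i j = α j) ∧ (∑ i, (∑ j, p.1 i j) * p.2 i = n)}

theorem partialDeriv_eq_fderiv {d : ℕ} {f : (Fin d → ℝ) → ℝ} {x : Fin d → ℝ}
    (hf : DifferentiableAt ℝ f x) (i : Fin d) :
    partialDeriv i f x = fderiv ℝ f x (Pi.single i 1) := by
  have hu : HasDerivAt (fun t => Function.update x i t) (Pi.single i 1) (x i) :=
    hasDerivAt_update x i (x i)
  have hf' : HasFDerivAt f (fderiv ℝ f x) (Function.update x i (x i)) := by
    simpa using hf.hasFDerivAt
  exact (hf'.comp_hasDerivAt (x i) hu).deriv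

theorem partialDeriv_congr {d : ℕ} {V : Set (Fin d → ℝ)} (hV : IsOpen V)
    {f₁ f₂ : (Fin d → ℝ) → ℝ} (hf : Set.EqOn f₁ f₂ V) (i : Fin d) :
    Set.EqOn (partialDeriv i f₁) (partialDeriv i f₂) V := by
  intro x hx
  refine Filter.EventuallyEq.deriv_eq ?_
  have hc : ContinuousAt (fun t : ℝ => Function.update x i t) (x i) :=
    (continuous_const.update i continuous_id).continuousAt
  have hmem : ∀ᶠ t in nhds (x i), Function.update x i t ∈ V :=
    hc (hV.mem_nhds (by simpa using hx))
  filter_upwards [hmem] with t ht using hf ht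

theorem partialDeriv_iterate_congr {d : ℕ} {V : Set (Fin d → ℝ)} (hV : IsOpen V)
    {f₁ f₂ : (Fin d → ℝ) → ℝ} (hf : Set.EqOn f₁ f₂ V) (i : Fin d) (k : ℕ) :
    Set.EqOn ((partialDeriv i)^[k] f₁) ((partialDeriv i)^[k] f₂) V := by
  induction k with
  | zero => exact hf
  | succ k ih =>
    simp only [Function.iterate_succ_apply']
    exact partialDeriv_congr hV ih i

theorem ContDiffOn.partialDeriv {d : ℕ} {V : Set (Fin d → ℝ)} (hV : IsOpen V)
    {f : (Fin d → ℝ) → ℝ} (hf : ContDiffOn ℝ (⊤ : ℕ∞) f V) (i : Fin d) :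
    ContDiffOn ℝ (⊤ : ℕ∞) (partialDeriv i f) V := by
  have h1 : ContDiffOn ℝ (⊤ : ℕ∞) (fun x => fderiv ℝ f x (Pi.single i 1)) V :=
    (hf.fderiv_of_isOpen hV (by simp)).clm_apply contDiffOn_const
  refine h1.congr fun x hx => partialDeriv_eq_fderiv ?_ i
  exact (hf.contDiffAt (hV.mem_nhds hx)).differentiableAt (by simp)

theorem ContDiffOn.partialDeriv_iterate {d : ℕ} {V : Set (Fin d → ℝ)} (hV : IsOpen V)
    {f : (Fin d → ℝ) → ℝ} (hf : ContDiffOn ℝ (⊤ : ℕ∞) f V) (i : Fin d) (k : ℕ) :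
    ContDiffOn ℝ (⊤ : ℕ∞) ((_root_.partialDeriv i)^[k] f) V := by
  induction k with
  | zero => exact hf
  | succ k ih =>
    rw [Function.iterate_succ_apply']
    exact ContDiffOn.partialDeriv hV ih i

theorem partialDeriv_comm {d : ℕ} {V : Set (Fin d → ℝ)} (hV : IsOpen V)
    {f : (Fin d → ℝ) → ℝ} (hf : ContDiffOn ℝ (⊤ : ℕ∞) f V) (i j : Fin d) :
    Set.EqOn (partialDeriv i (partialDeriv j f)) (partialDeriv j (partialDeriv i f)) V := by
  have key : ∀ i j : Fin d, ∀ x ∈ V, partialDeriv i (partialDeriv j f) x =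
      fderiv ℝ (fderiv ℝ f) x (Pi.single i 1) (Pi.single j 1) := by
    intro i j x hx
    have hfd : DifferentiableAt ℝ (fderiv ℝ f) x :=
      ((hf.fderiv_of_isOpen (m := (⊤ : ℕ∞)) hV (by simp)).contDiffAt
        (hV.mem_nhds hx)).differentiableAt (by simp)
    have heq : Set.EqOn (partialDeriv j f) (fun y => fderiv ℝ f y (Pi.single j 1)) V :=
      fun y hy => partialDeriv_eq_fderiv
        ((hf.contDiffAt (hV.mem_nhds hy)).differentiableAt (by simp)) j
    rw [partialDeriv_congr hV heq i hx, partialDeriv_eq_fderiv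
      (hfd.clm_apply (differentiableAt_const _)), fderiv_clm_apply hfd (differentiableAt_const _)]
    simp
  intro x hx
  rw [key i j x hx, key j i x hx]
  exact (hf.contDiffAt (hV.mem_nhds hx)).isSymmSndFDerivAt
    (by simpa using WithTop.coe_le_coe.mpr (le_top : (2 : ℕ∞) ≤ ⊤)) _ _

theorem partialDeriv_iterate_comm {d : ℕ} {V : Set (Fin d → ℝ)} (hV : IsOpen V)
    {f : (Fin d → ℝ) → ℝ} (hf : ContDiffOn ℝ (⊤ : ℕ∞) f V) (i j : Fin d) (k : ℕ) :
    Set.EqOn (partialDeriv i ((partialDeriv j)^[k] f)) ((partialDeriv j)^[k] (partialDeriv i f))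
      V := by
  induction k with
  | zero => exact fun x _ => rfl
  | succ k ih =>
    simp only [Function.iterate_succ_apply']
    exact (partialDeriv_comm hV (ContDiffOn.partialDeriv_iterate hV hf j k) i j).trans
      (partialDeriv_congr hV ih j)

/-- The iterated partial derivative along the variables of a list. -/
noncomputable def partialDerivList {d : ℕ} (l : List (Fin d)) (α : Fin d → ℕ)
    (f : (Fin d → ℝ) → ℝ) : (Fin d → ℝ) → ℝ :=
  l.foldr (fun i g => (partialDeriv i)^[α i] g) f

theorem ContDiffOn.partialDerivList {d : ℕ} {V : Set (Fin d → ℝ)} (hV : IsOpen V)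
    {f : (Fin d → ℝ) → ℝ} (hf : ContDiffOn ℝ (⊤ : ℕ∞) f V) (l : List (Fin d)) (α : Fin d → ℕ) :
    ContDiffOn ℝ (⊤ : ℕ∞) (partialDerivList l α f) V := by
  induction l with
  | nil => exact hf
  | cons j t ih => exact ContDiffOn.partialDeriv_iterate hV ih j (α j)

theorem partialDeriv_partialDerivList {d : ℕ} {V : Set (Fin d → ℝ)} (hV : IsOpen V)
    {f : (Fin d → ℝ) → ℝ} (hf : ContDiffOn ℝ (⊤ : ℕ∞) f V) (i : Fin d) (l : List (Fin d))
    (α : Fin d → ℕ) :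
    Set.EqOn (partialDeriv i (partialDerivList l α f)) (partialDerivList l α (partialDeriv i f))
      V := by
  induction l with
  | nil => exact fun x _ => rfl
  | cons j t ih =>
    exact (partialDeriv_iterate_comm hV (ContDiffOn.partialDerivList hV hf t α) i j (α j)).trans
      (partialDeriv_iterate_congr hV ih j (α j))

theorem partialDerivList_add_single_of_notMem {d : ℕ} (f : (Fin d → ℝ) → ℝ) (i : Fin d)
    (l : List (Fin d)) (hi : i ∉ l) (α : Fin d → ℕ) :
    partialDerivList l (α + Pi.single i 1) f = partialDerivList l α f := by
  induction l with
  | nil => rfl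
  | cons j t ih =>
    simp only [List.mem_cons, not_or] at hi
    have hj : (α + Pi.single i 1 : Fin d → ℕ) j = α j := by
      simp [Pi.single_eq_of_ne (Ne.symm hi.1)]
    change (partialDeriv j)^[_] (partialDerivList t _ f) = _
    rw [hj, ih hi.2]
    rfl

theorem partialDerivList_add_single {d : ℕ} {V : Set (Fin d → ℝ)} (hV : IsOpen V)
    {f : (Fin d → ℝ) → ℝ} (hf : ContDiffOn ℝ (⊤ : ℕ∞) f V) (i : Fin d) (l : List (Fin d))
    (hl : l.Nodup) (hi : i ∈ l) (α : Fin d → ℕ) :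
    Set.EqOn (partialDerivList l (α + Pi.single i 1) f)
      (partialDerivList l α (partialDeriv i f)) V := by
  induction l with
  | nil => simp at hi
  | cons j t ih =>
    rw [List.nodup_cons] at hl
    change Set.EqOn ((partialDeriv j)^[_] (partialDerivList t _ f))
      ((partialDeriv j)^[_] (partialDerivList t _ _)) V
    by_cases hij : i = j
    · subst hij
      rw [partialDerivList_add_single_of_notMem f i t hl.1]
      simp only [Pi.add_apply, Pi.single_eq_same, Function.iterate_succ_apply]
      exact partialDeriv_iterate_congr hV (partialDeriv_partialDerivList hV hf i t α) i (α i)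
    · have hj : (α + Pi.single i 1 : Fin d → ℕ) j = α j := by
        simp [Pi.single_eq_of_ne (Ne.symm hij)]
      rw [hj]
      have hit : i ∈ t := by simpa [hij] using hi
      exact partialDeriv_iterate_congr hV (ih hl.2 hit) j (α j)

theorem partialDerivMulti_add_single {d : ℕ} {V : Set (Fin d → ℝ)} (hV : IsOpen V)
    {f : (Fin d → ℝ) → ℝ} (hf : ContDiffOn ℝ (⊤ : ℕ∞) f V) (i : Fin d) (α : Fin d → ℕ) :
    Set.EqOn (partialDerivMulti (α + Pi.single i 1) f)
      (partialDerivMulti α (partialDeriv i f)) V :=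
  partialDerivList_add_single hV hf i _ (List.nodup_finRange d) (List.mem_finRange i) α

theorem partialDerivMulti_zero {d : ℕ} (f : (Fin d → ℝ) → ℝ) : partialDerivMulti 0 f = f := by
  have key : ∀ l : List (Fin d), partialDerivList l 0 f = f := by
    intro l
    induction l with
    | nil => rfl
    | cons j t ih => exact ih
  exact key _

/-- The Taylor series of `f` at `x`, as a formal power series. -/
noncomputable def taylorPowerSeries (f : ℝ → ℝ) (x : ℝ) : PowerSeries ℝ :=
  PowerSeries.mk fun k => iteratedDeriv k f x / k.factorial

theorem taylorPowerSeries_congr {f₁ f₂ : ℝ → ℝ} {x : ℝ} (hf : f₁ =ᶠ[nhds x] f₂) :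
    taylorPowerSeries f₁ x = taylorPowerSeries f₂ x := by
  ext k
  simp [taylorPowerSeries, hf.iteratedDeriv_eq k]

theorem taylorPowerSeries_mul {f₁ f₂ : ℝ → ℝ} {x : ℝ} (h₁ : ContDiffAt ℝ (⊤ : ℕ∞) f₁ x)
    (h₂ : ContDiffAt ℝ (⊤ : ℕ∞) f₂ x) :
    taylorPowerSeries (fun y => f₁ y * f₂ y) x =
      taylorPowerSeries f₁ x * taylorPowerSeries f₂ x := by
  ext k
  rw [PowerSeries.coeff_mul, Finset.Nat.sum_antidiagonal_eq_sum_range_succ_mk]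
  simp only [taylorPowerSeries, PowerSeries.coeff_mk]
  rw [iteratedDeriv_fun_mul (h₁.of_le (by exact_mod_cast le_top))
    (h₂.of_le (by exact_mod_cast le_top)), Finset.sum_div]
  refine Finset.sum_congr rfl fun i hi => ?_
  have hik : i ≤ k := by simpa [Nat.lt_succ_iff] using hi
  rw [Nat.cast_choose ℝ hik]
  have := Nat.factorial_ne_zero
  field_simp

theorem taylorPowerSeries_sum {ι : Type*} (s : Finset ι) {f : ι → ℝ → ℝ} {x : ℝ}
    (hf : ∀ i ∈ s, ContDiffAt ℝ (⊤ : ℕ∞) (f i) x) :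
    taylorPowerSeries (fun y => ∑ i ∈ s, f i y) x = ∑ i ∈ s, taylorPowerSeries (f i) x := by
  ext k
  simp only [taylorPowerSeries, map_sum, PowerSeries.coeff_mk]
  rw [iteratedDeriv_fun_sum fun i hi => (hf i hi).of_le (by exact_mod_cast le_top),
    Finset.sum_div]

theorem derivative_taylorPowerSeries (f : ℝ → ℝ) (x : ℝ) :
    PowerSeries.derivative ℝ (taylorPowerSeries f x) = taylorPowerSeries (deriv f) x := by
  ext k
  simp only [PowerSeries.coeff_derivative, taylorPowerSeries, PowerSeries.coeff_mk,
    iteratedDeriv_succ', Nat.factorial_succ]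
  have := Nat.factorial_ne_zero
  push_cast
  field_simp

theorem PowerSeries.derivative_prod {R ι : Type*} [CommSemiring R] [DecidableEq ι] (s : Finset ι)
    (f : ι → PowerSeries R) :
    PowerSeries.derivative R (∏ i ∈ s, f i) =
      ∑ i ∈ s, (∏ j ∈ s.erase i, f j) * PowerSeries.derivative R (f i) := by
  induction s using Finset.induction_on with
  | empty => simp
  | insert a s ha ih =>
    rw [Finset.prod_insert ha, Derivation.leibniz, ih, Finset.sum_insert ha,
      Finset.erase_insert ha, smul_eq_mul, smul_eq_mul, Finset.mul_sum, add_comm]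
    congr 1
    refine Finset.sum_congr rfl fun i hi => ?_
    have hia : a ≠ i := fun h => ha (h ▸ hi)
    rw [Finset.erase_insert_of_ne hia, Finset.prod_insert (by simp [ha]), mul_assoc]

/-- The finset of multi-indices of order at most `N`. -/
def multiIndicesLE (d N : ℕ) : Finset (Fin d → ℕ) :=
  (Fintype.piFinset fun _ => Finset.range (N + 1)).filter fun α => ∑ j, α j ≤ N

theorem mem_multiIndicesLE {d N : ℕ} {α : Fin d → ℕ} :
    α ∈ multiIndicesLE d N ↔ ∑ j, α j ≤ N := by
  simp only [multiIndicesLE, Finset.mem_filter, Fintype.mem_piFinset, Finset.mem_range,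
    and_iff_right_iff_imp]
  intro hα i
  have := Finset.single_le_sum (f := α) (fun _ _ => Nat.zero_le _) (Finset.mem_univ i)
  omega

/-- The power series `∑_{|α| ≤ N} ∂^α h(y) / α! G^α`. -/
noncomputable def taylorComp {d : ℕ} (G : Fin d → PowerSeries ℝ) (y : Fin d → ℝ) (N : ℕ)
    (h : (Fin d → ℝ) → ℝ) : PowerSeries ℝ :=
  ∑ α ∈ multiIndicesLE d N,
    PowerSeries.C (partialDerivMulti α h y) *
      ∏ i, (PowerSeries.C ((α i).factorial : ℝ)⁻¹ * G i ^ α i)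

theorem coeff_zero_taylorComp {d : ℕ} {G : Fin d → PowerSeries ℝ}
    (hG : ∀ i, PowerSeries.constantCoeff (G i) = 0) (y : Fin d → ℝ) (N : ℕ)
    (h : (Fin d → ℝ) → ℝ) : PowerSeries.coeff 0 (taylorComp G y N h) = h y := by
  rw [taylorComp, map_sum, Finset.sum_eq_single 0]
  · simp [partialDerivMulti_zero]
  · intro α _ hα
    obtain ⟨i, hi⟩ := Function.ne_iff.mp hα
    have hi' : α i ≠ 0 := hi
    simp only [PowerSeries.coeff_zero_eq_constantCoeff, map_mul, map_prod, map_pow, hG]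
    rw [Finset.prod_eq_zero (Finset.mem_univ i) (by simp [hi']), mul_zero]
  · intro h0
    exact absurd (mem_multiIndicesLE.mpr (by simp)) h0

theorem derivative_inv_factorial_mul_pow_succ (f : PowerSeries ℝ) (k : ℕ) :
    PowerSeries.derivative ℝ (PowerSeries.C ((k + 1).factorial : ℝ)⁻¹ * f ^ (k + 1)) =
      (PowerSeries.C (k.factorial : ℝ)⁻¹ * f ^ k) * PowerSeries.derivative ℝ f := by
  rw [Derivation.leibniz, PowerSeries.derivative_pow]
  have hk : PowerSeries.C ((k + 1).factorial : ℝ)⁻¹ * ((k + 1 : ℕ) : PowerSeries ℝ) =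
      PowerSeries.C (k.factorial : ℝ)⁻¹ := by
    have : ((k + 1 : ℕ) : PowerSeries ℝ) = PowerSeries.C ((k + 1 : ℕ) : ℝ) := by simp
    rw [this, ← map_mul, Nat.factorial_succ]
    congr 1
    have := Nat.factorial_ne_zero
    push_cast
    field_simp
  simp only [PowerSeries.derivative_C, smul_eq_mul, mul_zero, add_zero, ← hk,
    Nat.add_sub_cancel]
  ring

theorem derivative_taylorComp {d : ℕ} {V : Set (Fin d → ℝ)} (hV : IsOpen V)
    {y : Fin d → ℝ} (hy : y ∈ V) {h : (Fin d → ℝ) → ℝ} (hh : ContDiffOn ℝ (⊤ : ℕ∞) h V)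
    (G : Fin d → PowerSeries ℝ) (N : ℕ) :
    PowerSeries.derivative ℝ (taylorComp G y (N + 1) h) =
      ∑ i, taylorComp G y N (partialDeriv i h) * PowerSeries.derivative ℝ (G i) := by
  simp only [taylorComp, map_sum, Finset.sum_mul]
  have expand : ∀ α : Fin d → ℕ, PowerSeries.derivative ℝ
      (PowerSeries.C (partialDerivMulti α h y) *
        ∏ i, (PowerSeries.C ((α i).factorial : ℝ)⁻¹ * G i ^ α i)) =
      ∑ i, PowerSeries.C (partialDerivMulti α h y) *
        ((∏ j ∈ Finset.univ.erase i, (PowerSeries.C ((α j).factorial : ℝ)⁻¹ * G j ^ α j)) *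
          PowerSeries.derivative ℝ (PowerSeries.C ((α i).factorial : ℝ)⁻¹ * G i ^ α i)) := by
    intro α
    rw [Derivation.leibniz, PowerSeries.derivative_prod, PowerSeries.derivative_C, smul_zero,
      add_zero, smul_eq_mul, Finset.mul_sum]
  simp only [expand]
  rw [Finset.sum_comm]
  refine Finset.sum_congr rfl fun i _ => ?_
  symm
  refine Finset.sum_of_injOn (fun α => α + Pi.single i 1) (fun α _ β _ hαβ => by simpa using hαβ)
    ?_ ?_ ?_
  · intro α hα
    simp only [Finset.mem_coe, mem_multiIndicesLE] at hα ⊢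
    simp [Finset.sum_add_distrib, hα]
  · intro α hα hα'
    have hi : α i = 0 := by
      by_contra hne
      refine hα' ⟨α - Pi.single i 1, ?_, ?_⟩
      · simp only [Finset.mem_coe, mem_multiIndicesLE] at hα ⊢
        have hle : Pi.single i 1 ≤ α := by
          intro j
          rcases eq_or_ne j i with rfl | hj
          · simpa [Nat.one_le_iff_ne_zero] using hne
          · simp [Pi.single_eq_of_ne hj]
        have hsum : ∑ j, (α - Pi.single i 1 + Pi.single i 1 : Fin d → ℕ) j = ∑ j, α j := by
          rw [tsub_add_cancel_of_le hle]
        simp only [Pi.add_apply, Finset.sum_add_distrib, Finset.sum_pi_single',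
          Finset.mem_univ, if_true] at hsum
        omega
      · ext j
        rcases eq_or_ne j i with rfl | hj
        · simp; omega
        · simp [Pi.single_eq_of_ne hj]
    simp [hi]
  · intro α _
    rw [partialDerivMulti_add_single hV hh i α hy]
    simp only [Pi.add_apply, Pi.single_eq_same]
    rw [derivative_inv_factorial_mul_pow_succ, mul_assoc, ← mul_assoc (Finset.prod _ _),
      ← Finset.prod_erase_mul _ _ (Finset.mem_univ i)]
    congr 3
    refine Finset.prod_congr rfl fun j hj => ?_
    simp [Pi.single_eq_of_ne (Finset.ne_of_mem_erase hj)]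

theorem deriv_comp_eq_sum_partialDeriv {d : ℕ} {h : (Fin d → ℝ) → ℝ} {g : ℝ → Fin d → ℝ} {x : ℝ}
    (hh : DifferentiableAt ℝ h (g x)) (hg : DifferentiableAt ℝ g x) :
    deriv (fun x => h (g x)) x =
      ∑ i, partialDeriv i h (g x) * deriv (fun x => g x i) x := by
  have hc := (hh.hasFDerivAt.comp_hasDerivAt x hg.hasDerivAt).deriv
  have hgi : ∀ i, deriv (fun x => g x i) x = deriv g x i := fun i =>
    ((hasDerivAt_pi.mp hg.hasDerivAt) i).deriv
  have hsum : deriv g x = ∑ i, deriv g x i • (Pi.single i 1 : Fin d → ℝ) := by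
    ext j
    simp [Finset.sum_apply, Pi.single_apply]
  change deriv (h ∘ g) x = _
  rw [hc, hsum, map_sum]
  refine Finset.sum_congr rfl fun i _ => ?_
  rw [map_smul, partialDeriv_eq_fderiv hh, hgi, smul_eq_mul, mul_comm]

/-- The Taylor coefficients of `h ∘ g` agree with those of the formal composition. -/
theorem coeff_taylorPowerSeries_comp {d : ℕ} {V : Set (Fin d → ℝ)} (hV : IsOpen V)
    {g : ℝ → Fin d → ℝ} {x₀ : ℝ} (hgV : g x₀ ∈ V) {I : Set ℝ} (hI : IsOpen I) (hx₀ : x₀ ∈ I)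
    (hg : ContDiffOn ℝ (⊤ : ℕ∞) g I) {G : Fin d → PowerSeries ℝ}
    (hG₀ : ∀ i, PowerSeries.constantCoeff (G i) = 0)
    {M : ℕ} (hG : ∀ i, ∀ k < M, PowerSeries.coeff k (PowerSeries.derivative ℝ (G i)) =
      PowerSeries.coeff k (PowerSeries.derivative ℝ (taylorPowerSeries (fun x => g x i) x₀)))
    (n : ℕ) (hnM : n ≤ M) : ∀ N, n ≤ N → ∀ h : (Fin d → ℝ) → ℝ, ContDiffOn ℝ (⊤ : ℕ∞) h V →
      PowerSeries.coeff n (taylorPowerSeries (fun x => h (g x)) x₀) =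
        PowerSeries.coeff n (taylorComp G (g x₀) N h) := by
  induction n using Nat.strong_induction_on with
  | _ n ih =>
  intro N hnN h hh
  have hgx : ContDiffAt ℝ (⊤ : ℕ∞) g x₀ := hg.contDiffAt (hI.mem_nhds hx₀)
  cases n with
  | zero => simp [coeff_zero_taylorComp hG₀, taylorPowerSeries]
  | succ n =>
    obtain ⟨N, rfl⟩ : ∃ M, N = M + 1 := ⟨N - 1, by omega⟩
    have hderiv : deriv (fun x => h (g x)) =ᶠ[nhds x₀]
        fun x => ∑ i, partialDeriv i h (g x) * deriv (fun x => g x i) x := by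
      filter_upwards [hI.mem_nhds hx₀, hgx.continuousAt (hV.mem_nhds hgV)] with x hx hxV
      exact deriv_comp_eq_sum_partialDeriv
        ((hh.contDiffAt (hV.mem_nhds hxV)).differentiableAt (by simp))
        ((hg.contDiffAt (hI.mem_nhds hx)).differentiableAt (by simp))
    have hcomp : ∀ i, ContDiffAt ℝ (⊤ : ℕ∞) (fun x => partialDeriv i h (g x)) x₀ := fun i =>
      (((ContDiffOn.partialDeriv hV hh i).contDiffAt (hV.mem_nhds hgV)).comp x₀ hgx)
    have hgd : ∀ i, ContDiffAt ℝ (⊤ : ℕ∞) (deriv fun x => g x i) x₀ := fun i =>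
      (((contDiffOn_pi.mp hg i).deriv_of_isOpen hI (by simp)).contDiffAt (hI.mem_nhds hx₀))
    have hT : PowerSeries.derivative ℝ (taylorPowerSeries (fun x => h (g x)) x₀) =
        ∑ i, taylorPowerSeries (fun x => partialDeriv i h (g x)) x₀ *
          PowerSeries.derivative ℝ (taylorPowerSeries (fun x => g x i) x₀) := by
      rw [derivative_taylorPowerSeries, taylorPowerSeries_congr hderiv,
        taylorPowerSeries_sum _ fun i _ => (hcomp i).mul (hgd i)]
      refine Finset.sum_congr rfl fun i _ => ?_
      rw [taylorPowerSeries_mul (hcomp i) (hgd i), derivative_taylorPowerSeries]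
    have hcoeff : PowerSeries.coeff n
        (PowerSeries.derivative ℝ (taylorPowerSeries (fun x => h (g x)) x₀)) =
        PowerSeries.coeff n (PowerSeries.derivative ℝ (taylorComp G (g x₀) (N + 1) h)) := by
      rw [hT, derivative_taylorComp hV hgV hh, map_sum, map_sum]
      refine Finset.sum_congr rfl fun i _ => ?_
      rw [PowerSeries.coeff_mul, PowerSeries.coeff_mul]
      refine Finset.sum_congr rfl fun p hp => ?_
      have hp' := Finset.HasAntidiagonal.mem_antidiagonal.mp hp
      rw [hG i p.2 (by omega), ih p.1 (by omega) (by omega) N (by omega) _ (ContDiffOn.partialDeriv hV hh i)]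
    rw [PowerSeries.coeff_derivative, PowerSeries.coeff_derivative] at hcoeff
    exact mul_right_cancel₀ (by positivity) hcoeff

/-- The truncation `∑_{ℓ = 1}^n c ℓ X ^ ℓ`. -/
noncomputable def truncSeries (n : ℕ) (c : ℕ → ℝ) : PowerSeries ℝ :=
  ∑ l ∈ Finset.Icc 1 n, PowerSeries.C (c l) * PowerSeries.X ^ l

theorem inv_factorial_mul_truncSeries_pow (n : ℕ) (c : ℕ → ℝ) (k : ℕ) :
    PowerSeries.C (k.factorial : ℝ)⁻¹ * truncSeries n c ^ k =
      ∑ m ∈ Finset.piAntidiag (Finset.Icc 1 n) k,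
        PowerSeries.C (∏ l ∈ Finset.Icc 1 n, c l ^ m l / (m l).factorial) *
          PowerSeries.X ^ (∑ l ∈ Finset.Icc 1 n, m l * l) := by
  rw [truncSeries, Finset.sum_pow_eq_sum_piAntidiag, Finset.mul_sum]
  refine Finset.sum_congr rfl fun m hm => ?_
  have hsum : ∑ l ∈ Finset.Icc 1 n, m l = k := (Finset.mem_piAntidiag.mp hm).1
  have hX : ∏ l ∈ Finset.Icc 1 n, (PowerSeries.C (c l) * PowerSeries.X ^ l) ^ m l =
      PowerSeries.C (∏ l ∈ Finset.Icc 1 n, c l ^ m l) *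
        PowerSeries.X ^ (∑ l ∈ Finset.Icc 1 n, m l * l) := by
    rw [map_prod, ← Finset.prod_pow_eq_pow_sum, ← Finset.prod_mul_distrib]
    refine Finset.prod_congr rfl fun l _ => ?_
    rw [mul_pow, map_pow, ← pow_mul, mul_comm l]
  have hcast : ((Nat.multinomial (Finset.Icc 1 n) m : ℕ) : PowerSeries ℝ) =
      PowerSeries.C ((Nat.multinomial (Finset.Icc 1 n) m : ℕ) : ℝ) := by simp
  have hmul : ((∏ l ∈ Finset.Icc 1 n, ((m l).factorial : ℝ)) *
      (Nat.multinomial (Finset.Icc 1 n) m : ℝ)) = k.factorial := by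
    exact_mod_cast hsum ▸ Nat.multinomial_spec (Finset.Icc 1 n) m
  rw [hX, hcast, ← mul_assoc, ← mul_assoc, ← map_mul, ← map_mul]
  congr 2
  rw [Finset.prod_div_distrib, ← hmul]
  have h1 : (∏ l ∈ Finset.Icc 1 n, ((m l).factorial : ℝ)) ≠ 0 :=
    Finset.prod_ne_zero_iff.mpr fun l _ => by positivity
  have h2 : (Nat.multinomial (Finset.Icc 1 n) m : ℝ) ≠ 0 := by
    have := Nat.factorial_ne_zero k
    intro h0
    rw [h0, mul_zero] at hmul
    exact this (by exact_mod_cast hmul.symm)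
  field_simp

/-- The multiplicity arrays `m` with `∑_ℓ m i ℓ = α i` and `∑_i ∑_ℓ m i ℓ * ℓ = n`. -/
def multiplicityArrays (d n : ℕ) (α : Fin d → ℕ) : Finset (Fin d → ℕ → ℕ) :=
  (Fintype.piFinset fun i => Finset.piAntidiag (Finset.Icc 1 n) (α i)).filter
    fun m => ∑ i, ∑ l ∈ Finset.Icc 1 n, m i l * l = n

theorem mem_multiplicityArrays {d n : ℕ} {α : Fin d → ℕ} {m : Fin d → ℕ → ℕ} :
    m ∈ multiplicityArrays d n α ↔
      (∀ i, ∑ l ∈ Finset.Icc 1 n, m i l = α i ∧ ∀ l, m i l ≠ 0 → l ∈ Finset.Icc 1 n) ∧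
        ∑ i, ∑ l ∈ Finset.Icc 1 n, m i l * l = n := by
  rw [multiplicityArrays, Finset.mem_filter, Fintype.mem_piFinset]
  simp only [Finset.mem_piAntidiag]

theorem coeff_prod_truncSeries_pow {d : ℕ} (n : ℕ) (c : Fin d → ℕ → ℝ) (α : Fin d → ℕ) :
    PowerSeries.coeff n
        (∏ i, (PowerSeries.C ((α i).factorial : ℝ)⁻¹ * truncSeries n (c i) ^ α i)) =
      ∑ m ∈ multiplicityArrays d n α,
        ∏ l ∈ Finset.Icc 1 n, ∏ i, c i l ^ m i l / (m i l).factorial := by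
  simp only [inv_factorial_mul_truncSeries_pow, Finset.prod_univ_sum, map_sum,
    Finset.prod_mul_distrib, ← map_prod, Finset.prod_pow_eq_pow_sum]
  rw [multiplicityArrays, Finset.sum_filter]
  refine Finset.sum_congr rfl fun m _ => ?_
  rw [PowerSeries.coeff_C_mul, PowerSeries.coeff_X_pow, Finset.prod_comm]
  simp only [eq_comm (a := n), mul_ite, mul_one, mul_zero]

/-- The multiplicity array of a tuple `(k_1, …, k_s; ℓ_1, …, ℓ_s)`. -/
def toMultiplicityArray {d s : ℕ} (p : (Fin s → Fin d → ℕ) × (Fin s → ℕ)) : Fin d → ℕ → ℕ :=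
  fun i l => ∑ j, if p.2 j = l then p.1 j i else 0

theorem toMultiplicityArray_apply {d s : ℕ} {p : (Fin s → Fin d → ℕ) × (Fin s → ℕ)}
    (hp : Function.Injective p.2) (i : Fin d) (j : Fin s) :
    toMultiplicityArray p i (p.2 j) = p.1 j i := by
  simp [toMultiplicityArray, hp.eq_iff]

theorem toMultiplicityArray_of_notMem {d s : ℕ} {p : (Fin s → Fin d → ℕ) × (Fin s → ℕ)}
    (i : Fin d) {l : ℕ} (hl : l ∉ Set.range p.2) : toMultiplicityArray p i l = 0 :=
  Finset.sum_eq_zero fun j _ => if_neg fun h => hl ⟨j, h⟩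

theorem le_of_mem_Ps {d n s : ℕ} {α : Fin d → ℕ} {p : (Fin s → Fin d → ℕ) × (Fin s → ℕ)}
    (hp : p ∈ Ps d n s α) (j : Fin s) : p.2 j ∈ Finset.Icc 1 n := by
  obtain ⟨h1, h2, -, -, h5⟩ := hp
  refine Finset.mem_Icc.mpr ⟨h2 j, ?_⟩
  calc p.2 j ≤ (∑ i, p.1 j i) * p.2 j := Nat.le_mul_of_pos_left _ (h1 j)
    _ ≤ ∑ j, (∑ i, p.1 j i) * p.2 j :=
      Finset.single_le_sum (f := fun j => (∑ i, p.1 j i) * p.2 j)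
        (fun _ _ => Nat.zero_le _) (Finset.mem_univ j)
    _ = n := h5

theorem finite_Ps (d n s : ℕ) (α : Fin d → ℕ) : (Ps d n s α).Finite := by
  have hk : (Set.pi Set.univ fun _ : Fin s => Set.pi Set.univ fun i : Fin d =>
      Set.Iic (α i)).Finite :=
    Set.Finite.pi fun _ => Set.Finite.pi fun i => Set.finite_Iic (α i)
  have hl : (Set.pi Set.univ fun _ : Fin s => Set.Iic n).Finite :=
    Set.Finite.pi fun _ => Set.finite_Iic n
  refine (hk.prod hl).subset fun p hp => ⟨fun j _ i _ => ?_, fun j _ => ?_⟩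
  · rw [Set.mem_Iic, ← hp.2.2.2.1 i]
    exact Finset.single_le_sum (f := fun j => p.1 j i) (fun _ _ => Nat.zero_le _)
      (Finset.mem_univ j)
  · exact (Finset.mem_Icc.mp (le_of_mem_Ps hp j)).2

/-- A commutative-monoid-valued product over `Icc 1 n` that is trivial away from the `ℓ_j`. -/
theorem prod_Icc_eq_prod_of_mem_Ps {M : Type*} [CommMonoid M] {d n s : ℕ} {α : Fin d → ℕ}
    {p : (Fin s → Fin d → ℕ) × (Fin s → ℕ)} (hp : p ∈ Ps d n s α) (F : ℕ → M)
    (hF : ∀ l, l ∉ Set.range p.2 → F l = 1) :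
    ∏ l ∈ Finset.Icc 1 n, F l = ∏ j, F (p.2 j) := by
  symm
  refine Finset.prod_of_injOn p.2 hp.2.2.1.injective.injOn (fun j _ => le_of_mem_Ps hp j) ?_
    fun _ _ => rfl
  intro l _ hl
  exact hF l (by simpa using hl)

theorem sum_Icc_eq_sum_of_mem_Ps {d n s : ℕ} {α : Fin d → ℕ}
    {p : (Fin s → Fin d → ℕ) × (Fin s → ℕ)} (hp : p ∈ Ps d n s α) (F : ℕ → ℕ)
    (hF : ∀ l, l ∉ Set.range p.2 → F l = 0) :
    ∑ l ∈ Finset.Icc 1 n, F l = ∑ j, F (p.2 j) :=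
  prod_Icc_eq_prod_of_mem_Ps (M := Multiplicative ℕ) hp F hF

theorem toMultiplicityArray_mem {d n s : ℕ} {α : Fin d → ℕ}
    {p : (Fin s → Fin d → ℕ) × (Fin s → ℕ)} (hp : p ∈ Ps d n s α) :
    toMultiplicityArray p ∈ multiplicityArrays d n α := by
  have hinj := hp.2.2.1.injective
  refine mem_multiplicityArrays.mpr ⟨fun i => ⟨?_, fun l hl => ?_⟩, ?_⟩
  · rw [sum_Icc_eq_sum_of_mem_Ps hp _ fun l hl => toMultiplicityArray_of_notMem i hl]
    simp only [toMultiplicityArray_apply hinj]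
    exact hp.2.2.2.1 i
  · by_contra hmem
    refine hl (toMultiplicityArray_of_notMem i ?_)
    rintro ⟨j, rfl⟩
    exact hmem (le_of_mem_Ps hp j)
  · rw [Finset.sum_comm, sum_Icc_eq_sum_of_mem_Ps hp]
    · simp only [toMultiplicityArray_apply hinj, ← Finset.sum_mul]
      exact hp.2.2.2.2
    · intro l hl
      simp [toMultiplicityArray_of_notMem _ hl]

theorem range_eq_of_mem_Ps {d n s : ℕ} {α : Fin d → ℕ}
    {p : (Fin s → Fin d → ℕ) × (Fin s → ℕ)} (hp : p ∈ Ps d n s α) :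
    Set.range p.2 = {l | ∃ i, toMultiplicityArray p i l ≠ 0} := by
  ext l
  constructor
  · rintro ⟨j, rfl⟩
    simp only [Set.mem_ofPred_eq, toMultiplicityArray_apply hp.2.2.1.injective]
    by_contra! hcon
    exact (hp.1 j).ne' (Finset.sum_eq_zero fun i _ => hcon i)
  · rintro ⟨i, hi⟩
    by_contra hl
    exact hi (toMultiplicityArray_of_notMem i hl)

theorem toMultiplicityArray_injective {d n : ℕ} {α : Fin d → ℕ} {s s' : ℕ}
    {p : (Fin s → Fin d → ℕ) × (Fin s → ℕ)} {p' : (Fin s' → Fin d → ℕ) × (Fin s' → ℕ)}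
    (hp : p ∈ Ps d n s α) (hp' : p' ∈ Ps d n s' α)
    (h : toMultiplicityArray p = toMultiplicityArray p') :
    (⟨s, p⟩ : Σ s : ℕ, (Fin s → Fin d → ℕ) × (Fin s → ℕ)) = ⟨s', p'⟩ := by
  have hrange : Set.range p.2 = Set.range p'.2 := by
    rw [range_eq_of_mem_Ps hp, range_eq_of_mem_Ps hp', h]
  have hs : s = s' := by
    have := congrArg Set.ncard hrange
    rwa [← Set.image_univ, ← Set.image_univ, Set.ncard_image_of_injective _ hp.2.2.1.injective,
      Set.ncard_image_of_injective _ hp'.2.2.1.injective, Set.ncard_univ, Set.ncard_univ,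
      Nat.card_fin, Nat.card_fin] at this
  subst hs
  have h2 : p.2 = p'.2 := (StrictMono.range_inj hp.2.2.1 hp'.2.2.1).mp hrange
  have h1 : p.1 = p'.1 := by
    ext j i
    rw [← toMultiplicityArray_apply hp.2.2.1.injective, h, h2,
      toMultiplicityArray_apply hp'.2.2.1.injective]
  rw [Prod.ext h1 h2]

theorem exists_toMultiplicityArray_eq {d n : ℕ} {α : Fin d → ℕ} (hα : 1 ≤ ∑ i, α i)
    {m : Fin d → ℕ → ℕ} (hm : m ∈ multiplicityArrays d n α) :
    ∃ s ∈ Finset.Icc 1 n, ∃ p ∈ Ps d n s α, toMultiplicityArray p = m := by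
  obtain ⟨hm1, hm2⟩ := mem_multiplicityArrays.mp hm
  set T : Finset ℕ := (Finset.Icc 1 n).filter fun l => ∃ i, m i l ≠ 0 with hT
  have memT : ∀ l, l ∈ T ↔ ∃ i, m i l ≠ 0 := fun l => by
    rw [hT, Finset.mem_filter]
    exact ⟨fun h => h.2, fun h => ⟨(hm1 _).2 l h.choose_spec, h⟩⟩
  have notMemT : ∀ l, l ∉ T → ∀ i, m i l = 0 := fun l hl i => by
    by_contra h
    exact hl ((memT l).mpr ⟨i, h⟩)
  have hcard1 : 1 ≤ T.card := by
    rw [Nat.one_le_iff_ne_zero, Finset.card_ne_zero]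
    by_contra hne
    rw [Finset.not_nonempty_iff_eq_empty] at hne
    have : ∀ i, α i = 0 := fun i => by
      rw [← (hm1 i).1]
      exact Finset.sum_eq_zero fun l _ => notMemT l (by simp [hne]) i
    simp [this] at hα
  have hcard2 : T.card ≤ n := by
    simpa using Finset.card_le_card (Finset.filter_subset (fun l => ∃ i, m i l ≠ 0)
      (Finset.Icc 1 n))
  let e := T.orderEmbOfFin rfl
  have he : ∀ j, e j ∈ T := fun j => Finset.orderEmbOfFin_mem T rfl j
  have hrange : Set.range e = T := Finset.range_orderEmbOfFin T rfl
  have hsum : ∀ F : ℕ → ℕ, (∀ l, l ∉ T → F l = 0) →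
      ∑ j, F (e j) = ∑ l ∈ Finset.Icc 1 n, F l := fun F hF => by
    refine Finset.sum_of_injOn e e.injective.injOn
      (fun j _ => (Finset.mem_filter.mp (he j)).1) (fun l _ hl => hF l fun hlT => hl ?_)
      fun _ _ => rfl
    rw [← Finset.mem_coe, ← hrange] at hlT
    simpa using hlT
  refine ⟨T.card, Finset.mem_Icc.mpr ⟨hcard1, hcard2⟩, (fun j i => m i (e j), e), ?_, ?_⟩
  · refine ⟨fun j => ?_, fun j => ?_, e.strictMono, fun i => ?_, ?_⟩
    · obtain ⟨i, hi⟩ := (memT _).mp (he j)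
      exact Finset.sum_pos' (fun _ _ => Nat.zero_le _)
        ⟨i, Finset.mem_univ i, Nat.pos_of_ne_zero hi⟩
    · exact (Finset.mem_Icc.mp (Finset.mem_filter.mp (he j)).1).1
    · exact (hsum (fun l => m i l) fun l hl => notMemT l hl i).trans (hm1 i).1
    · refine (hsum (fun l => (∑ i, m i l) * l) fun l hl => ?_).trans ?_
      · simp [notMemT l hl]
      · simp only [Finset.sum_mul]
        rw [Finset.sum_comm, hm2]
  · ext i l
    by_cases hl : l ∈ T
    · rw [← Finset.mem_coe, ← hrange] at hl
      obtain ⟨j, rfl⟩ := hl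
      exact toMultiplicityArray_apply (p := (fun j i => m i (e j), e)) e.injective i j
    · rw [notMemT l hl i]
      refine toMultiplicityArray_of_notMem i ?_
      rwa [hrange, Finset.mem_coe]

theorem sum_multiplicityArrays_eq {d n : ℕ} {α : Fin d → ℕ} (hα : 1 ≤ ∑ i, α i)
    (a : Fin d → ℕ → ℝ) :
    ∑ m ∈ multiplicityArrays d n α,
        ∏ l ∈ Finset.Icc 1 n, ∏ i, (a i l / l.factorial) ^ m i l / (m i l).factorial =
      ∑ s ∈ Finset.Icc 1 n, ∑ᶠ p ∈ Ps d n s α,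
        ∏ j : Fin s, (∏ i, a i (p.2 j) ^ p.1 j i) /
          ((∏ i, ((p.1 j i).factorial : ℝ)) * ((p.2 j).factorial : ℝ) ^ (∑ i, p.1 j i)) := by
  simp only [finsum_mem_eq_finite_toFinset_sum _ (finite_Ps d n _ α)]
  rw [Finset.sum_sigma']
  symm
  refine Finset.sum_bij (fun x _ => toMultiplicityArray x.2) ?_ ?_ ?_ ?_
  · rintro ⟨s, p⟩ hx
    simp only [Finset.mem_sigma, Set.Finite.mem_toFinset] at hx
    exact toMultiplicityArray_mem hx.2
  · rintro ⟨s, p⟩ hx ⟨s', p'⟩ hx' heq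
    simp only [Finset.mem_sigma, Set.Finite.mem_toFinset] at hx hx'
    exact toMultiplicityArray_injective hx.2 hx'.2 heq
  · intro m hm
    obtain ⟨s, hs, p, hp, hpm⟩ := exists_toMultiplicityArray_eq hα hm
    exact ⟨⟨s, p⟩, by simpa [hp] using hs, hpm⟩
  · rintro ⟨s, p⟩ hx
    simp only [Finset.mem_sigma, Set.Finite.mem_toFinset] at hx
    rw [prod_Icc_eq_prod_of_mem_Ps hx.2]
    · refine Finset.prod_congr rfl fun j _ => ?_
      simp only [toMultiplicityArray_apply hx.2.2.2.1.injective, div_pow]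
      rw [Finset.prod_div_distrib, Finset.prod_div_distrib, Finset.prod_pow_eq_pow_sum, div_div,
        mul_comm]
    · intro l hl
      simp [toMultiplicityArray_of_notMem _ hl]

theorem coeff_truncSeries (n : ℕ) (c : ℕ → ℝ) (k : ℕ) :
    PowerSeries.coeff k (truncSeries n c) = if k ∈ Finset.Icc 1 n then c k else 0 := by
  simp only [truncSeries, map_sum, PowerSeries.coeff_C_mul, PowerSeries.coeff_X_pow, mul_ite,
    mul_one, mul_zero, Finset.sum_ite_eq]

/-- **Multivariate Faà di Bruno formula.** -/
theorem multivariate_faa_di_bruno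
    (d : ℕ) (hd : 1 ≤ d) (h : (Fin d → ℝ) → ℝ) (g : ℝ → (Fin d → ℝ)) (x₀ : ℝ)
    (V : Set (Fin d → ℝ)) (hVopen : IsOpen V) (hV : V ∈ nhds (g x₀))
    (hh : ContDiffOn ℝ (⊤ : ℕ∞) h V)
    (I : Set ℝ) (hIopen : IsOpen I) (hI : I ∈ nhds x₀) (hg : ContDiffOn ℝ (⊤ : ℕ∞) g I)
    (n : ℕ) (hn : 1 ≤ n) :
    iteratedDeriv n (fun x => h (g x)) x₀ =
      (n.factorial : ℝ) *
        ∑ᶠ α ∈ {α : Fin d → ℕ | 1 ≤ ∑ j, α j ∧ ∑ j, α j ≤ n},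
          partialDerivMulti α h (g x₀) *
            ∑ s ∈ Finset.Icc 1 n,
              ∑ᶠ p ∈ Ps d n s α,
                ∏ j : Fin s,
                  (∏ i : Fin d, (iteratedDeriv (p.2 j) (fun x => g x i) x₀) ^ (p.1 j i)) /
                    ((∏ i : Fin d, ((p.1 j i).factorial : ℝ)) *
                      ((p.2 j).factorial : ℝ) ^ (∑ i, p.1 j i)) := by
  set c : Fin d → ℕ → ℝ := fun i l => iteratedDeriv l (fun x => g x i) x₀ / l.factorial with hc
  have hG₀ : ∀ i, PowerSeries.constantCoeff (truncSeries n (c i)) = 0 := fun i => by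
    rw [← PowerSeries.coeff_zero_eq_constantCoeff_apply, coeff_truncSeries]
    simp
  have hG : ∀ i, ∀ k < n, PowerSeries.coeff k (PowerSeries.derivative ℝ (truncSeries n (c i))) =
      PowerSeries.coeff k
        (PowerSeries.derivative ℝ (taylorPowerSeries (fun x => g x i) x₀)) := fun i k hk => by
    rw [PowerSeries.coeff_derivative, PowerSeries.coeff_derivative, coeff_truncSeries,
      if_pos (Finset.mem_Icc.mpr ⟨by omega, by omega⟩), taylorPowerSeries, PowerSeries.coeff_mk]
  have hcoeff := coeff_taylorPowerSeries_comp hVopen (mem_of_mem_nhds hV) hIopen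
    (mem_of_mem_nhds hI) hg hG₀ hG n le_rfl n le_rfl h hh
  rw [taylorPowerSeries, PowerSeries.coeff_mk,
    div_eq_iff (by exact_mod_cast n.factorial_ne_zero), mul_comm] at hcoeff
  rw [hcoeff]
  congr 1
  have hindex : {α : Fin d → ℕ | 1 ≤ ∑ j, α j ∧ ∑ j, α j ≤ n} =
      ((multiIndicesLE d n).filter fun α => 1 ≤ ∑ j, α j : Finset (Fin d → ℕ)) := by
    ext α
    simp [mem_multiIndicesLE, and_comm]
  rw [hindex, finsum_mem_coe_finset, taylorComp, map_sum]
  symm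
  refine Finset.sum_subset_zero_on_sdiff (Finset.filter_subset _ _) ?_ ?_
  · intro α hα
    have hα0 : ∀ i, α i = 0 := by
      simp only [Finset.mem_sdiff, Finset.mem_filter, not_and] at hα
      have hsum : ∑ j, α j = 0 := by
        have := hα.2 hα.1
        omega
      simpa using hsum
    simp [hα0, PowerSeries.coeff_C, Nat.one_le_iff_ne_zero.mp hn]
  · intro α hα
    rw [PowerSeries.coeff_C_mul, coeff_prod_truncSeries_pow,
      ← sum_multiplicityArrays_eq (Finset.mem_filter.mp hα).2
        fun i l => iteratedDeriv l (fun x => g x i) x₀]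
end

section
/- For every integer n ≥ 1, Σ_{0 ≤ m ≤ r ≤ n} (m+1) · (−1)^m · binom(1/2, m+1) · (−1)^{r−m−1} · binom(1/2, r−m) · (−1)^{n−r−1} · binom(1/2, n−r) ≤ 4(n+1) · (−1)^n · binom(1/2, n+1), where the sum is over all pairs of integers (m, r) with 0 ≤ m ≤ r ≤ n. -/
/-- The generalized binomial coefficient `binom(1/2, j)`, with the nonstandard
convention `binom(1/2, 0) = -1`. -/
noncomputable def halfBinom (j : ℕ) : ℝ :=
  if j = 0 then -1 else (∏ k ∈ Finset.range j, ((1 : ℝ) / 2 - (k : ℝ))) / (j.factorial : ℝ)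

open PowerSeries in
/-- A power series `T` whose derivative times `1 - X` is `-T`, with constant term `1` has derivative `-1`. -/
theorem PowerSeries.derivative_eq_neg_one_of_ode {T : ℝ⟦X⟧} (h0 : coeff 0 T = 1)
    (h : (1 - X) * d⁄dX ℝ T = -T) : d⁄dX ℝ T = -1 := by
  have hrec : ∀ n : ℕ, coeff (n + 1) (d⁄dX ℝ T) = coeff n (d⁄dX ℝ T) - coeff (n + 1) T := by
    intro n
    have h' := congrArg (coeff (n + 1)) h
    rw [sub_mul, one_mul, map_sub, coeff_succ_X_mul, map_neg] at h'
    linarith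
  have hzero : coeff 0 (d⁄dX ℝ T) = -1 := by
    have h' := congrArg (coeff 0) h
    rw [sub_mul, one_mul, map_sub, coeff_zero_X_mul, map_neg, h0] at h'
    linarith
  have hsucc : ∀ n : ℕ, coeff (n + 1) (d⁄dX ℝ T) = 0 := by
    intro n
    induction n with
    | zero =>
      have h1 := hrec 0
      have h2 := hzero
      rw [coeff_derivative] at h2
      rw [h1, hzero]
      norm_num at h2 ⊢
      linarith
    | succ n ih =>
      have h1 := hrec (n + 1)
      have h2 := ih
      rw [coeff_derivative] at h2
      have h3 : coeff (n + 1 + 1) T = 0 := by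
        rcases mul_eq_zero.mp h2 with h4 | h4
        · exact h4
        · exact absurd h4 (by positivity)
      rw [h1, ih, h3, sub_zero]
  ext n
  cases n with
  | zero => simpa using hzero
  | succ n => simpa [coeff_one] using hsucc n

/-- The nonnegative number `(-1)^(j-1) * binom(1/2, j)`. -/
noncomputable def absHalfBinom (j : ℕ) : ℝ := -((-1 : ℝ) ^ j * halfBinom j)

theorem absHalfBinom_zero : absHalfBinom 0 = 1 := by
  simp [absHalfBinom, halfBinom]

theorem absHalfBinom_one : absHalfBinom 1 = 1 / 2 := by
  simp [absHalfBinom, halfBinom]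

theorem succ_mul_absHalfBinom_succ (n : ℕ) :
    ((n : ℝ) + 2) * absHalfBinom (n + 2) = ((n : ℝ) + 1 / 2) * absHalfBinom (n + 1) := by
  have h1 : ((n + 1).factorial : ℝ) ≠ 0 := by positivity
  have h2 : (n : ℝ) + 1 + 1 ≠ 0 := by positivity
  simp only [absHalfBinom, halfBinom, Nat.succ_ne_zero, if_false]
  rw [Finset.prod_range_succ _ (n + 1), Nat.factorial_succ (n + 1)]
  push_cast
  field_simp
  ring

theorem absHalfBinom_nonneg (n : ℕ) : 0 ≤ absHalfBinom n := by
  cases n with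
  | zero => simp [absHalfBinom_zero]
  | succ n =>
    induction n with
    | zero => norm_num [absHalfBinom_one]
    | succ n ih =>
      have h := succ_mul_absHalfBinom_succ n
      have h' : 0 ≤ ((n : ℝ) + 2) * absHalfBinom (n + 2) := h ▸ by positivity
      exact nonneg_of_mul_nonneg_right h' (by positivity)

theorem neg_one_zpow_mul_halfBinom {m r : ℕ} (h : m ≤ r) :
    (-1 : ℝ) ^ ((r : ℤ) - (m : ℤ) - 1) * halfBinom (r - m) = absHalfBinom (r - m) := by
  rw [← Nat.cast_sub h, zpow_sub₀ (by norm_num), zpow_natCast, absHalfBinom]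
  simp [div_neg]

open PowerSeries in
/-- With `A = ∑ absHalfBinom j X ^ j = 2 - √(1 - X)`, the product of
its derivative `D` with `A ^ 2` is `4 D - 1 - A / 2`. -/
theorem derivative_mul_sq_absHalfBinom :
    d⁄dX ℝ (mk absHalfBinom) * mk absHalfBinom * mk absHalfBinom =
      C (4 : ℝ) * d⁄dX ℝ (mk absHalfBinom) - C (1 : ℝ) - C (1 / 2 : ℝ) * mk absHalfBinom := by
  set A : ℝ⟦X⟧ := mk absHalfBinom with hA
  have hode : C (2 : ℝ) * ((1 - X) * d⁄dX ℝ A) = C (2 : ℝ) - A := by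
    ext n
    rw [coeff_C_mul, sub_mul, one_mul, map_sub, map_sub]
    rcases n with _ | _ | n
    · rw [coeff_zero_X_mul]
      simp [coeff_derivative, hA, absHalfBinom_zero, absHalfBinom_one]
      norm_num
    · rw [coeff_succ_X_mul]
      have h := succ_mul_absHalfBinom_succ 0
      simp [coeff_derivative, hA, absHalfBinom_one] at h ⊢
      linarith
    · rw [coeff_succ_X_mul]
      have h := succ_mul_absHalfBinom_succ (n + 1)
      simp [coeff_derivative, hA] at h ⊢
      linarith
  have hC2 : C (2 : ℝ) = (2 : ℝ⟦X⟧) := map_ofNat _ 2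
  have hC4 : C (4 : ℝ) = (4 : ℝ⟦X⟧) := map_ofNat _ 4
  have hC1 : C (1 : ℝ) = (1 : ℝ⟦X⟧) := map_one _
  have hCh : C (1 / 2 : ℝ) * 2 = (1 : ℝ⟦X⟧) := by
    rw [← hC2, ← map_mul]; norm_num
  rw [hC2] at hode
  have hder : d⁄dX ℝ ((2 - A) * (2 - A)) = -(2 * ((2 - A) * d⁄dX ℝ A)) := by
    have h2 : d⁄dX ℝ (2 - A) = -d⁄dX ℝ A := by
      rw [map_sub, ← hC2, derivative_C, zero_sub]
    rw [Derivation.leibniz, h2, smul_eq_mul]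
    ring
  have hT : d⁄dX ℝ ((2 - A) * (2 - A)) = -1 := by
    refine derivative_eq_neg_one_of_ode ?_ ?_
    · rw [← hC2]
      simp [hA, absHalfBinom_zero]
      norm_num
    · rw [hder]
      linear_combination (-(2 - A)) * hode
  rw [hder] at hT
  rw [hC4, hC1]
  linear_combination (2 - C (1 / 2 : ℝ) * (2 - A)) * hT
    + (1 - (2 - A) * (2 - A) * d⁄dX ℝ A) * hCh

theorem triple_sum_combinatorial_inequality (n : ℕ) (hn : 1 ≤ n) :
    (∑ r ∈ Finset.range (n + 1), ∑ m ∈ Finset.range (r + 1),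
      ((m : ℝ) + 1) * (-1 : ℝ) ^ m * halfBinom (m + 1) *
        ((-1 : ℝ) ^ ((r : ℤ) - (m : ℤ) - 1) * halfBinom (r - m)) *
        ((-1 : ℝ) ^ ((n : ℤ) - (r : ℤ) - 1) * halfBinom (n - r)))
      ≤ 4 * ((n : ℝ) + 1) * (-1 : ℝ) ^ n * halfBinom (n + 1) := by
  have hpos (m : ℕ) : (-1 : ℝ) ^ m * halfBinom (m + 1) = absHalfBinom (m + 1) := by
    rw [absHalfBinom, pow_succ]
    ring
  have hcoeff := congrArg (PowerSeries.coeff n) derivative_mul_sq_absHalfBinom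
  rw [map_sub, map_sub, PowerSeries.coeff_C_mul, PowerSeries.coeff_C_mul, PowerSeries.coeff_C,
    if_neg (Nat.one_le_iff_ne_zero.mp hn)] at hcoeff
  simp only [PowerSeries.coeff_mul, Finset.Nat.sum_antidiagonal_eq_sum_range_succ_mk,
    PowerSeries.coeff_derivative, PowerSeries.coeff_mk, Finset.sum_mul] at hcoeff
  have hsum : (∑ r ∈ Finset.range (n + 1), ∑ m ∈ Finset.range (r + 1),
      ((m : ℝ) + 1) * (-1 : ℝ) ^ m * halfBinom (m + 1) *
        ((-1 : ℝ) ^ ((r : ℤ) - (m : ℤ) - 1) * halfBinom (r - m)) *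
        ((-1 : ℝ) ^ ((n : ℤ) - (r : ℤ) - 1) * halfBinom (n - r))) =
      ∑ r ∈ Finset.range (n + 1), ∑ m ∈ Finset.range (r + 1),
        absHalfBinom (m + 1) * ((m : ℝ) + 1) * absHalfBinom (r - m) * absHalfBinom (n - r) := by
    refine Finset.sum_congr rfl fun r hr => Finset.sum_congr rfl fun m hm => ?_
    rw [neg_one_zpow_mul_halfBinom (Finset.mem_range_succ_iff.mp hr),
      neg_one_zpow_mul_halfBinom (Finset.mem_range_succ_iff.mp hm), mul_assoc ((m : ℝ) + 1), hpos]
    ring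
  rw [hsum, hcoeff, mul_assoc (4 * ((n : ℝ) + 1)), hpos]
  linarith [absHalfBinom_nonneg n]
end

section
/- Define, for integers m ≥ 0, a_m = 2(m+1)·(−1)^m·binom(1/2, m+1) and b_m = (−1)^{m−1}·binom(1/2, m). Then for every integer n ≥ 1 the triple convolution S_n = Σ_{r=0}^n Σ_{m=0}^r a_m · b_{r−m} · b_{n−r} satisfies the exact identity S_n = 4 a_n − b_n = ((16n − 10)/(2n − 1)) · (n+1) · (−1)^n · binom(1/2, n+1). -/
/-- `a_m = 2(m+1)·(−1)^m·binom(1/2, m+1)`. -/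
noncomputable def aCoef (m : ℕ) : ℝ := 2 * ((m : ℝ) + 1) * (-1 : ℝ) ^ m * halfBinom (m + 1)

/-- `b_m = (−1)^{m−1}·binom(1/2, m)` (with an integer exponent, so that `b_0 = 1`). -/
noncomputable def bCoef (m : ℕ) : ℝ := (-1 : ℝ) ^ ((m : ℤ) - 1) * halfBinom m

lemma halfBinom_succ_succ (n : ℕ) :
    halfBinom (n + 2) = halfBinom (n + 1) * (-((n : ℝ) + 1 / 2)) / ((n : ℝ) + 2) := by
  have h₁ : ((n + 1).factorial : ℝ) ≠ 0 := by positivity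
  have h₂ : (n : ℝ) + 2 ≠ 0 := by positivity
  simp only [halfBinom, Nat.add_eq_zero_iff, OfNat.ofNat_ne_zero, one_ne_zero, and_false, if_false]
  rw [Finset.prod_range_succ _ (n + 1), Nat.factorial_succ (n + 1)]
  push_cast
  field_simp
  ring

lemma bCoef_zero : bCoef 0 = 1 := by
  simp [bCoef, halfBinom]

lemma bCoef_succ (n : ℕ) : bCoef (n + 1) = (-1 : ℝ) ^ n * halfBinom (n + 1) := by
  simp [bCoef]

lemma bCoef_succ_succ (n : ℕ) :
    ((n : ℝ) + 2) * bCoef (n + 2) = ((n : ℝ) + 1 / 2) * bCoef (n + 1) := by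
  have h : (n : ℝ) + 2 ≠ 0 := by positivity
  rw [bCoef_succ, bCoef_succ, halfBinom_succ_succ]
  field_simp
  ring

lemma aCoef_eq_bCoef_succ (n : ℕ) : aCoef n = 2 * ((n : ℝ) + 1) * bCoef (n + 1) := by
  rw [aCoef, bCoef_succ]
  ring

lemma aCoef_zero : aCoef 0 = 1 := by
  simp [aCoef, halfBinom]

lemma aCoef_succ_sub (n : ℕ) : aCoef (n + 1) - aCoef n = -bCoef (n + 1) := by
  rw [aCoef_eq_bCoef_succ, aCoef_eq_bCoef_succ]
  push_cast
  linear_combination 2 * bCoef_succ_succ n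

lemma aCoef_succ_mul (n : ℕ) :
    aCoef (n + 1) * ((n : ℝ) + 1) = ((n : ℝ) + 1 / 2) * aCoef n := by
  rw [aCoef_eq_bCoef_succ, aCoef_eq_bCoef_succ]
  push_cast
  linear_combination 2 * ((n : ℝ) + 1) * bCoef_succ_succ n

open PowerSeries in
lemma two_sub_mk_bCoef :
    2 - PowerSeries.mk bCoef = (1 - X) * PowerSeries.mk aCoef := by
  ext n
  rw [← map_ofNat (C (R := ℝ)) 2]
  cases n with
  | zero => simp [bCoef_zero, aCoef_zero]; norm_num
  | succ n =>
    simp only [sub_mul, one_mul, map_sub, coeff_mk, coeff_succ_X_mul, coeff_C, Nat.succ_ne_zero,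
      if_false, aCoef_succ_sub]
    ring

open PowerSeries in
lemma one_sub_X_mul_derivative_mk_aCoef :
    2 * ((1 - X) * d⁄dX ℝ (PowerSeries.mk aCoef)) = PowerSeries.mk aCoef := by
  ext n
  rw [← map_ofNat (C (R := ℝ)) 2, coeff_C_mul, sub_mul, one_mul, map_sub]
  cases n with
  | zero =>
    have h := aCoef_succ_mul 0
    simp [coeff_derivative] at h ⊢
    linarith
  | succ n =>
    have h := aCoef_succ_mul (n + 1)
    simp only [coeff_succ_X_mul, coeff_derivative, coeff_mk]
    push_cast at h ⊢
    linear_combination 2 * h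

open PowerSeries in
/-- The generating function of `aCoef` is `1 / √(1 - X)`. -/
lemma one_sub_X_mul_mk_aCoef_sq :
    (1 - X) * PowerSeries.mk aCoef ^ 2 = 1 := by
  apply derivative.ext
  · have h := one_sub_X_mul_derivative_mk_aCoef
    simp only [Derivation.leibniz, Derivation.leibniz_pow, map_sub,
      derivative_X, smul_eq_mul, nsmul_eq_mul, Derivation.map_one_eq_zero]
    push_cast
    linear_combination PowerSeries.mk aCoef * h
  · simp [aCoef_zero]

open PowerSeries in
lemma mk_aCoef_mul_mk_bCoef_sq :
    PowerSeries.mk aCoef * PowerSeries.mk bCoef * PowerSeries.mk bCoef =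
      4 * PowerSeries.mk aCoef - 2 - PowerSeries.mk bCoef := by
  have hb := two_sub_mk_bCoef
  have ha := one_sub_X_mul_mk_aCoef_sq
  have hab : PowerSeries.mk aCoef * (2 - PowerSeries.mk bCoef) = 1 := by
    rw [hb]
    linear_combination ha
  linear_combination (-2 - PowerSeries.mk bCoef) * hab

open PowerSeries in
lemma sum_aCoef_bCoef_bCoef (n : ℕ) (hn : 1 ≤ n) :
    (∑ r ∈ Finset.range (n + 1), ∑ m ∈ Finset.range (r + 1),
        aCoef m * bCoef (r - m) * bCoef (n - r)) = 4 * aCoef n - bCoef n := by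
  have h := congrArg (coeff n) mk_aCoef_mul_mk_bCoef_sq
  rw [← map_ofNat (C (R := ℝ)) 4, ← map_ofNat (C (R := ℝ)) 2, map_sub, map_sub, coeff_C_mul,
    coeff_C, if_neg (by omega)] at h
  simp only [coeff_mul, coeff_mk, Finset.Nat.sum_antidiagonal_eq_sum_range_succ_mk,
    Finset.sum_mul, sub_zero] at h
  exact h

theorem triple_convolution_exact_identity (n : ℕ) (hn : 1 ≤ n) :
    (∑ r ∈ Finset.range (n + 1), ∑ m ∈ Finset.range (r + 1),
        aCoef m * bCoef (r - m) * bCoef (n - r))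
      = 4 * aCoef n - bCoef n ∧
    (∑ r ∈ Finset.range (n + 1), ∑ m ∈ Finset.range (r + 1),
        aCoef m * bCoef (r - m) * bCoef (n - r))
      = (16 * (n : ℝ) - 10) / (2 * (n : ℝ) - 1) * ((n : ℝ) + 1) * (-1 : ℝ) ^ n *
          halfBinom (n + 1) := by
  refine ⟨sum_aCoef_bCoef_bCoef n hn, ?_⟩
  rw [sum_aCoef_bCoef_bCoef n hn, mul_assoc _ ((-1 : ℝ) ^ n), ← bCoef_succ, aCoef_eq_bCoef_succ]
  obtain ⟨k, rfl⟩ := Nat.exists_eq_add_of_le' hn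
  have h := bCoef_succ_succ k
  have hk : 2 * ((k : ℝ) + 1) - 1 ≠ 0 := by
    have : (0 : ℝ) ≤ k := k.cast_nonneg
    linarith
  push_cast
  field_simp
  linear_combination 2 * h
end

section
/- Let I ⊂ ℝ be an open interval, let g : I → ℝ be a bounded C^∞ function, and let h : ℝ → ℝ be a real analytic function on an open set containing the closure of g(I). If g satisfies the ODE g′(x) = h(g(x)) for all x ∈ I, then g is real analytic on I. -/
open Filter Topology in
/-- A function analytic at a point has, near this point, a primitive analytic at the point. -/
theorem AnalyticAt.exists_analyticAt_hasDerivAt {𝕜 : Type*} [RCLike 𝕜] {f : 𝕜 → 𝕜} {x : 𝕜}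
    (hf : AnalyticAt 𝕜 f x) :
    ∃ F : 𝕜 → 𝕜, AnalyticAt 𝕜 F x ∧ ∀ᶠ y in 𝓝 x, HasDerivAt F (f y) y := by
  obtain ⟨p, hp⟩ := hf
  let q : FormalMultilinearSeries 𝕜 𝕜 𝕜 :=
    .ofScalars 𝕜 fun n => p.coeff (n - 1) / (n : 𝕜)
  have hq : 0 < q.radius := by
    obtain ⟨r, hr0, hr⟩ := ENNReal.lt_iff_exists_nnreal_btwn.1 hp.radius_pos
    obtain ⟨C, hC, hpC⟩ := p.norm_mul_pow_le_of_lt_radius hr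
    refine hr0.trans_le (q.le_radius_of_bound (C * r) fun n => ?_)
    rcases n with _ | n
    · simpa [q] using by positivity
    · have h1 : ‖q (n + 1)‖ ≤ ‖p n‖ := by
        have hn : (1 : ℝ) ≤ ‖((n + 1 : ℕ) : 𝕜)‖ := by
          rw [RCLike.norm_natCast]; exact_mod_cast Nat.le_add_left 1 n
        rw [FormalMultilinearSeries.ofScalars_norm, norm_div,
          FormalMultilinearSeries.norm_apply_eq_norm_coef]
        exact div_le_self (norm_nonneg _) hn
      calc ‖q (n + 1)‖ * (r : ℝ) ^ (n + 1) ≤ ‖p n‖ * (r : ℝ) ^ (n + 1) := by gcongr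
        _ = ‖p n‖ * (r : ℝ) ^ n * r := by ring
        _ ≤ C * r := by gcongr; exact hpC n
  have hF : HasFPowerSeriesOnBall (fun y => q.sum (y - x)) q x q.radius := by
    simpa using (q.hasFPowerSeriesOnBall hq).comp_sub x
  refine ⟨fun y => q.sum (y - x), hF.analyticAt, ?_⟩
  have hsum : ∀ᶠ z in 𝓝 (0 : 𝕜), deriv (fun y => q.sum (y - x)) (x + z) = f (x + z) := by
    filter_upwards [hasFPowerSeriesAt_iff.1 hp, hasFPowerSeriesAt_iff.1 hF.fderiv.hasFPowerSeriesAt]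
      with z hz hz'
    have h1 := (ContinuousLinearMap.apply 𝕜 𝕜 (1 : 𝕜)).hasSum hz'
    refine h1.unique ?_
    convert hz using 2 with n
    have hn : (n : 𝕜) + 1 ≠ 0 := by exact_mod_cast n.succ_ne_zero
    simp [q, FormalMultilinearSeries.derivSeries_coeff_one, mul_div_cancel₀ _ hn]
  have hx : Tendsto (fun y => y - x) (𝓝 x) (𝓝 0) := by
    simpa using (continuous_sub_right x).tendsto x
  filter_upwards [hx.eventually hsum, hF.analyticAt.eventually_analyticAt] with y hy hy'
  have := hy'.differentiableAt.hasDerivAt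
  simp only [add_sub_cancel] at hy
  rwa [hy] at this

open Filter Topology in
/-- A local solution of an autonomous scalar ODE with analytic right-hand side is analytic. -/
theorem AnalyticAt.of_eventually_hasDerivAt_comp {g h : ℝ → ℝ} {x : ℝ}
    (hh : AnalyticAt ℝ h (g x)) (hg : ∀ᶠ t in 𝓝 x, HasDerivAt g (h (g t)) t) :
    AnalyticAt ℝ g x := by
  have hgx : Tendsto g (𝓝 x) (𝓝 (g x)) := hg.self_of_nhds.continuousAt
  by_cases h0 : h (g x) = 0
  · obtain ⟨K, s, hs, hK⟩ := hh.hasStrictDerivAt.hasStrictFDerivAt.exists_lipschitzOnWith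
    have hconst : g =ᶠ[𝓝 x] fun _ => g x := by
      refine ODE_solution_unique_of_eventually (v := fun _ => h) (s := fun _ => s) (K := K)
        (.of_forall fun _ => hK) (hg.and (hgx.eventually hs)) (.of_forall fun t => ?_) rfl
      exact ⟨by simpa [h0] using hasDerivAt_const t (g x), mem_of_mem_nhds hs⟩
    exact analyticAt_const.congr hconst.symm
  · obtain ⟨F, hF, hF'⟩ := (hh.inv h0).exists_analyticAt_hasDerivAt
    have hder : deriv F (g x) ≠ 0 := by
      rw [hF'.self_of_nhds.deriv]
      exact inv_ne_zero h0
    have hFg : (fun t => F (g t)) =ᶠ[𝓝 x] fun t => t - x + F (g x) := by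
      refine ODE_solution_unique_of_eventually (v := fun _ _ => 1) (s := fun _ => Set.univ) (K := 0)
        (.of_forall fun _ => (LipschitzWith.const 1).lipschitzOnWith) ?_ ?_ (by simp)
      · filter_upwards [hg, hgx.eventually hF',
          hgx.eventually (hh.continuousAt.eventually_ne h0)] with t ht ht' hne
        refine ⟨?_, trivial⟩
        have := ht'.comp t ht
        rwa [Pi.inv_apply, inv_mul_cancel₀ hne] at this
      · exact .of_forall fun t =>
          ⟨((hasDerivAt_id t).sub_const x).add_const _, trivial⟩
    let G := hF.hasStrictDerivAt.localInverse _ _ _ hder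
    have hG : AnalyticAt ℝ G (x - x + F (g x)) := by
      simpa using hF.analyticAt_localInverse hder
    have hGF : ∀ᶠ y in 𝓝 (g x), G (F y) = y := HasStrictFDerivAt.eventually_left_inverse _
    have hGx : AnalyticAt ℝ (fun t => G (t - x + F (g x))) x :=
      hG.comp_of_eq (by fun_prop) rfl
    refine hGx.congr ?_
    filter_upwards [hFg, hgx.eventually hGF] with t ht ht'
    rw [← ht, ht']

/-- A bounded smooth solution of the ODE `g′ = h(g)`, with `h` real analytic on an open
set containing the closure of the range of `g`, is real analytic. -/
theorem analyticity_of_bounded_ODE_solution (a b : ℝ) (g h : ℝ → ℝ)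
    (hg : ContDiffOn ℝ (⊤ : ℕ∞) g (Set.Ioo a b))
    (hbdd : ∃ M : ℝ, ∀ x ∈ Set.Ioo a b, |g x| ≤ M)
    (U : Set ℝ) (hUopen : IsOpen U) (hclosure : closure (g '' Set.Ioo a b) ⊆ U)
    (hanal : AnalyticOnNhd ℝ h U)
    (hode : ∀ x ∈ Set.Ioo a b, HasDerivAt g (h (g x)) x) :
    AnalyticOnNhd ℝ g (Set.Ioo a b) := by
  intro x hx
  exact (hanal _ (hclosure (subset_closure ⟨x, hx, rfl⟩))).of_eventually_hasDerivAt_comp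
    (Filter.eventually_of_mem (isOpen_Ioo.mem_nhds hx) hode)
end

section
/- (One-dimensional Faà di Bruno formula.) Let I ⊂ ℝ be an open interval, let g ∈ C^∞(I), and let h ∈ C^∞(J), where J is an open set containing g(I). Let f = h ∘ g. Then for all n ≥ 1 and all x ∈ I, f^{(n)}(x) = Σ_{k=1}^n h^{(k)}(g(x)) · Σ_{𝐤 ∈ P(n,k)} (n!/𝐤!) · ∏_{j=1}^n ( g^{(j)}(x)/j! )^{k_j}. -/
/-- The index set `P(n,k)`: tuples `𝐤 = (k_1, …, k_n)` of nonnegative integers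
(indexed by `j : Fin n`, with `k_{j+1} = v j`) such that `Σ_{j=1}^n j·k_j = n` and
`Σ_{j=1}^n k_j = k`. -/
def Pnk (n k : ℕ) : Set (Fin n → ℕ) :=
  {v | (∑ j : Fin n, ((j : ℕ) + 1) * v j = n) ∧ (∑ j : Fin n, v j = k)}

open PowerSeries in
theorem hasDerivAt_coeff_mul {P Q : ℝ → ℝ⟦X⟧} {P' Q' : ℝ⟦X⟧} {x : ℝ}
    (hP : ∀ m, HasDerivAt (fun y => coeff m (P y)) (coeff m P') x)
    (hQ : ∀ m, HasDerivAt (fun y => coeff m (Q y)) (coeff m Q') x) (m : ℕ) :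
    HasDerivAt (fun y => coeff m (P y * Q y)) (coeff m (P' * Q x + P x * Q')) x := by
  simp only [map_add, coeff_mul, ← Finset.sum_add_distrib]
  exact HasDerivAt.fun_sum fun p _ => (hP p.1).mul (hQ p.2)

open PowerSeries in
theorem hasDerivAt_coeff_pow {P : ℝ → ℝ⟦X⟧} {P' : ℝ⟦X⟧} {x : ℝ}
    (hP : ∀ m, HasDerivAt (fun y => coeff m (P y)) (coeff m P') x) (k m : ℕ) :
    HasDerivAt (fun y => coeff m (P y ^ k)) (coeff m (k • (P x ^ (k - 1) * P'))) x := by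
  induction k generalizing m with
  | zero => simpa using hasDerivAt_const x (coeff m (1 : ℝ⟦X⟧))
  | succ k ih =>
    simp only [pow_succ (P _) k]
    convert hasDerivAt_coeff_mul ih hP m using 2
    rcases k with _ | k
    · simp
    · simp only [Nat.add_sub_cancel, nsmul_eq_mul]
      push_cast
      ring

theorem ContDiffOn.hasDerivAt_iteratedDeriv {s : Set ℝ} {g : ℝ → ℝ} {x : ℝ} (hs : IsOpen s)
    (hg : ContDiffOn ℝ (⊤ : ℕ∞) g s) (hx : x ∈ s) (k : ℕ) :
    HasDerivAt (iteratedDeriv k g) (iteratedDeriv (k + 1) g x) x := by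
  rw [iteratedDeriv_succ]
  refine DifferentiableAt.hasDerivAt ?_
  have h1 : DifferentiableOn ℝ (iteratedDerivWithin k g s) s :=
    hg.differentiableOn_iteratedDerivWithin (by exact_mod_cast WithTop.coe_lt_top k)
      hs.uniqueDiffOn
  refine (h1.differentiableAt (hs.mem_nhds hx)).congr_of_eventuallyEq ?_
  filter_upwards [hs.mem_nhds hx] with y hy
  exact (iteratedDerivWithin_of_isOpen hs hy).symm

/-- The formal power series `g(x + X) - g(x)`. -/
noncomputable def taylorIncrement (g : ℝ → ℝ) (x : ℝ) : PowerSeries ℝ :=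
  PowerSeries.mk fun j => if j = 0 then 0 else iteratedDeriv j g x / j.factorial

open PowerSeries in
theorem coeff_taylorIncrement_pow_of_lt (g : ℝ → ℝ) (x : ℝ) {n k : ℕ} (hnk : n < k) :
    coeff n (taylorIncrement g x ^ k) = 0 := by
  have h : (X : ℝ⟦X⟧) ∣ taylorIncrement g x := by
    rw [X_dvd_iff, ← coeff_zero_eq_constantCoeff_apply]
    simp [taylorIncrement]
  exact X_pow_dvd_iff.1 (pow_dvd_pow_of_dvd h k) n hnk

open PowerSeries in
theorem hasDerivAt_coeff_taylorIncrement_pow {s : Set ℝ} {g : ℝ → ℝ} {x : ℝ} (hs : IsOpen s)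
    (hg : ContDiffOn ℝ (⊤ : ℕ∞) g s) (hx : x ∈ s) (k n : ℕ) :
    HasDerivAt (fun y => coeff n (taylorIncrement g y ^ k))
      ((n + 1) * coeff (n + 1) (taylorIncrement g x ^ k)
        - k * iteratedDeriv 1 g x * coeff n (taylorIncrement g x ^ (k - 1))) x := by
  have hG : ∀ m, HasDerivAt (fun y => coeff m (taylorIncrement g y))
      (coeff m (d⁄dX ℝ (taylorIncrement g x) - C (iteratedDeriv 1 g x))) x := by
    intro m
    rcases m with _ | m
    · rw [map_sub, coeff_derivative, coeff_zero_C]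
      simpa [taylorIncrement] using hasDerivAt_const x (0 : ℝ)
    · simp only [taylorIncrement, coeff_mk, map_sub, coeff_derivative, coeff_C]
      simp only [Nat.add_eq_zero_iff, one_ne_zero, and_false, if_false, sub_zero]
      refine ((hg.hasDerivAt_iteratedDeriv hs hx (m + 1)).div_const _).congr_deriv ?_
      rw [Nat.factorial_succ (m + 1)]
      push_cast
      field_simp
  convert hasDerivAt_coeff_pow hG k n using 1
  have h : d⁄dX ℝ (taylorIncrement g x ^ k) = k • (taylorIncrement g x ^ (k - 1)
      * d⁄dX ℝ (taylorIncrement g x)) := by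
    rw [Derivation.leibniz_pow, smul_eq_mul]
  rw [mul_sub, smul_sub, ← h, map_sub, coeff_derivative, map_nsmul, coeff_mul_C, nsmul_eq_mul]
  ring

open PowerSeries in
theorem iteratedDeriv_comp_eq_sum_coeff {s J : Set ℝ} {g h : ℝ → ℝ} (hs : IsOpen s)
    (hJ : IsOpen J) (hgJ : Set.MapsTo g s J) (hg : ContDiffOn ℝ (⊤ : ℕ∞) g s)
    (hh : ContDiffOn ℝ (⊤ : ℕ∞) h J) {n N : ℕ} (hn : n ≤ N) {x : ℝ} (hx : x ∈ s) :
    iteratedDeriv n (h ∘ g) x = ∑ k ∈ Finset.range (N + 1), iteratedDeriv k h (g x) *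
      (n.factorial / k.factorial * coeff n (taylorIncrement g x ^ k)) := by
  induction n generalizing x with
  | zero =>
    rw [Finset.sum_range_succ', Finset.sum_eq_zero]
    · simp
    · intro k _
      rw [coeff_taylorIncrement_pow_of_lt g x k.succ_pos]
      simp
  | succ n ih =>
    have hg1 : HasDerivAt g (deriv g x) x := by
      simpa only [iteratedDeriv_zero, zero_add, iteratedDeriv_one] using
        hg.hasDerivAt_iteratedDeriv hs hx 0
    have hderiv := HasDerivAt.fun_sum (u := Finset.range (N + 1)) fun k _ =>
      ((hh.hasDerivAt_iteratedDeriv hJ (hgJ hx) k).comp x hg1).mul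
        ((hasDerivAt_coeff_taylorIncrement_pow hs hg hx k n).const_mul
          ((n.factorial : ℝ) / k.factorial))
    have heq : iteratedDeriv n (h ∘ g) =ᶠ[nhds x] fun y => ∑ k ∈ Finset.range (N + 1),
        iteratedDeriv k h (g y) *
          (n.factorial / k.factorial * coeff n (taylorIncrement g y ^ k)) := by
      filter_upwards [hs.mem_nhds hx] with y hy
      exact ih (by omega) hy
    rw [iteratedDeriv_succ, heq.deriv_eq]
    refine hderiv.deriv.trans ?_
    have hshift : ∑ k ∈ Finset.range (N + 1), iteratedDeriv (k + 1) h (g x) * deriv g x *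
          (n.factorial / k.factorial * coeff n (taylorIncrement g x ^ k))
        = ∑ k ∈ Finset.range (N + 1), iteratedDeriv k h (g x) * (n.factorial / k.factorial *
          (k * deriv g x * coeff n (taylorIncrement g x ^ (k - 1)))) := by
      rw [Finset.sum_range_succ, Finset.sum_range_succ',
        coeff_taylorIncrement_pow_of_lt g x (by omega : n < N)]
      simp only [mul_zero, add_zero, Nat.cast_zero, zero_mul, Nat.add_sub_cancel]
      refine Finset.sum_congr rfl fun k _ => ?_
      rw [Nat.factorial_succ]
      push_cast
      field_simp
    simp only [iteratedDeriv_one, Function.comp_apply, mul_sub, Finset.sum_add_distrib,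
      Finset.sum_sub_distrib, hshift]
    rw [add_sub_cancel]
    refine Finset.sum_congr rfl fun k _ => ?_
    rw [Nat.factorial_succ]
    push_cast
    ring

open PowerSeries in
theorem PowerSeries.coeff_pow_eq_sum_piAntidiag {R : Type*} [CommSemiring R] (F : R⟦X⟧)
    (hF : constantCoeff F = 0) (n k : ℕ) :
    coeff n (F ^ k) = ∑ v ∈ (Finset.univ : Finset (Fin n)).piAntidiag k with
        ∑ j : Fin n, ((j : ℕ) + 1) * v j = n,
      (Nat.multinomial Finset.univ v : R) * ∏ j : Fin n, coeff ((j : ℕ) + 1) F ^ v j := by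
  have htrunc : (trunc (n + 1) F : R⟦X⟧)
      = ∑ j : Fin n, monomial ((j : ℕ) + 1) (coeff ((j : ℕ) + 1) F) := by
    ext m
    rw [Polynomial.coeff_coe, coeff_trunc, map_sum]
    simp only [coeff_monomial]
    rcases m with _ | m
    · simp [hF]
    · simp only [add_left_inj, Nat.add_lt_add_iff_right]
      by_cases hm : m < n
      · rw [if_pos hm, Finset.sum_eq_single (⟨m, hm⟩ : Fin n)] <;>
          simp +contextual [Fin.ext_iff, eq_comm]
      · rw [if_neg hm, Finset.sum_eq_zero]
        intro j _
        exact if_neg (by omega)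
  have hcoeff : coeff n (F ^ k) = coeff n ((trunc (n + 1) F : R⟦X⟧) ^ k) := by
    have h := congrArg (Polynomial.coeff · n) (trunc_trunc_pow F (n + 1) k)
    simpa only [coeff_trunc, Nat.lt_succ_self, if_true] using h.symm
  rw [hcoeff, htrunc, Finset.sum_pow_eq_sum_piAntidiag, map_sum, Finset.sum_filter]
  refine Finset.sum_congr rfl fun v _ => ?_
  have hprod : ∏ j : Fin n, monomial ((j : ℕ) + 1) (coeff ((j : ℕ) + 1) F) ^ v j
      = monomial (∑ j : Fin n, ((j : ℕ) + 1) * v j)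
        (∏ j : Fin n, coeff ((j : ℕ) + 1) F ^ v j) := by
    simp only [monomial_pow, prod_monomial, mul_comm]
  rw [hprod, ← nsmul_eq_mul, map_nsmul, coeff_monomial, nsmul_eq_mul]
  simp [eq_comm]

/-- **One-dimensional Faà di Bruno formula.** -/
theorem one_dimensional_faa_di_bruno (a b : ℝ) (g h : ℝ → ℝ) (J : Set ℝ)
    (hJopen : IsOpen J) (hgJ : g '' Set.Ioo a b ⊆ J)
    (hg : ContDiffOn ℝ (⊤ : ℕ∞) g (Set.Ioo a b)) (hh : ContDiffOn ℝ (⊤ : ℕ∞) h J)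
    (n : ℕ) (hn : 1 ≤ n) (x : ℝ) (hx : x ∈ Set.Ioo a b) :
    iteratedDeriv n (h ∘ g) x =
      ∑ k ∈ Finset.Icc 1 n, iteratedDeriv k h (g x) *
        ∑ᶠ v ∈ Pnk n k,
          ((n.factorial : ℝ) / ∏ j : Fin n, ((v j).factorial : ℝ)) *
            ∏ j : Fin n,
              (iteratedDeriv ((j : ℕ) + 1) g x / (((j : ℕ) + 1).factorial : ℝ)) ^ (v j) := by
  have hmaps : Set.MapsTo g (Set.Ioo a b) J := Set.mapsTo_iff_image_subset.2 hgJ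
  rw [iteratedDeriv_comp_eq_sum_coeff isOpen_Ioo hJopen hmaps hg hh le_rfl
    hx, Finset.sum_range_succ', pow_zero, PowerSeries.coeff_one, if_neg (by omega), mul_zero,
    mul_zero, add_zero, Finset.range_eq_Ico, Finset.sum_Ico_add' (fun k => iteratedDeriv k h (g x) *
      ((n.factorial : ℝ) / k.factorial * PowerSeries.coeff n (taylorIncrement g x ^ k))), zero_add,
    Finset.Ico_add_one_right_eq_Icc]
  refine Finset.sum_congr rfl fun k _ => ?_
  have hP : Pnk n k = ↑({v ∈ (Finset.univ : Finset (Fin n)).piAntidiag k |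
      ∑ j : Fin n, ((j : ℕ) + 1) * v j = n} : Finset (Fin n → ℕ)) := by
    ext v
    simp [Pnk, and_comm]
  have h0 : PowerSeries.constantCoeff (taylorIncrement g x) = 0 := by
    rw [← PowerSeries.coeff_zero_eq_constantCoeff_apply]
    simp [taylorIncrement]
  rw [hP, finsum_mem_coe_finset, PowerSeries.coeff_pow_eq_sum_piAntidiag _ h0, Finset.mul_sum]
  congr 1
  refine Finset.sum_congr rfl fun v hv => ?_
  have hsum : ∑ j, v j = k := by simpa using (Finset.mem_filter.1 hv).1
  have hmult : (∏ j, ((v j).factorial : ℝ)) * Nat.multinomial Finset.univ v = k.factorial := by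
    rw [← hsum]
    exact_mod_cast Nat.multinomial_spec Finset.univ v
  have hne : ∏ j, ((v j).factorial : ℝ) ≠ 0 :=
    Finset.prod_ne_zero_iff.2 fun j _ => by positivity
  have hcoeff (j : Fin n) : PowerSeries.coeff ((j : ℕ) + 1) (taylorIncrement g x)
      = iteratedDeriv ((j : ℕ) + 1) g x / (((j : ℕ) + 1).factorial : ℝ) := by
    simp [taylorIncrement]
  simp only [hcoeff, ← mul_assoc]
  congr 1
  have hk : (k.factorial : ℝ) ≠ 0 := by positivity
  field_simp
  rw [← hmult]
  ring
end

section
/- (One-dimensional magic identity.) For each integer n ≥ 1, Σ_{k=1}^n Σ_{𝐤 ∈ P(n,k)} ( (−1)^k · k! / 𝐤! ) · ∏_{j=1}^n binom(1/2, j)^{k_j} = 2(n+1) · binom(1/2, n+1). -/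
open PowerSeries in
/-- The multinomial expansion of a coefficient of a power of `∑ j, c j * X ^ (j + 1)`, as a sum over
`Pnk n k`. -/
lemma finsum_Pnk_eq_coeff_pow (c : ℕ → ℝ) (n k : ℕ) :
    (∑ᶠ v ∈ Pnk n k,
        ((-1 : ℝ) ^ k * (k.factorial : ℝ) / ∏ j : Fin n, ((v j).factorial : ℝ)) *
          ∏ j : Fin n, (c ((j : ℕ) + 1)) ^ (v j)) =
      coeff n ((-∑ j : Fin n, C (c ((j : ℕ) + 1)) * X ^ ((j : ℕ) + 1)) ^ k : PowerSeries ℝ) := by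
  classical
  have hset : Pnk n k = ((Finset.univ.piAntidiag k).filter
      (fun v : Fin n → ℕ => ∑ j : Fin n, ((j : ℕ) + 1) * v j = n) : Finset (Fin n → ℕ)) := by
    ext v
    simp [Pnk, and_comm]
  rw [hset, finsum_mem_coe_finset, Finset.sum_filter,
    neg_pow (∑ j : Fin n, _), Finset.sum_pow_eq_sum_piAntidiag,
    Finset.mul_sum, map_sum]
  refine Finset.sum_congr rfl fun v hv => ?_
  have hk : ∑ j, v j = k := (Finset.mem_piAntidiag.mp hv).1
  have hmult : (Nat.multinomial Finset.univ v : ℝ) =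
      (k.factorial : ℝ) / ∏ j : Fin n, ((v j).factorial : ℝ) := by
    rw [eq_div_iff (Finset.prod_ne_zero_iff.mpr fun j _ => by positivity), mul_comm, ← hk]
    exact_mod_cast Nat.multinomial_spec Finset.univ v
  have hmono : (-1 : PowerSeries ℝ) ^ k * ((Nat.multinomial Finset.univ v : PowerSeries ℝ) *
      ∏ j : Fin n, (C (c ((j : ℕ) + 1)) * X ^ ((j : ℕ) + 1)) ^ v j) =
      C ((-1) ^ k * (Nat.multinomial Finset.univ v : ℝ) * ∏ j : Fin n, c ((j : ℕ) + 1) ^ v j) *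
        X ^ (∑ j : Fin n, ((j : ℕ) + 1) * v j) := by
    simp only [mul_pow, Finset.prod_mul_distrib, ← pow_mul, Finset.prod_pow_eq_pow_sum, map_mul,
      map_pow, map_prod, map_neg, map_one, map_natCast]
    ring
  rw [hmono, coeff_C_mul, coeff_X_pow, hmult]
  by_cases h : ∑ j : Fin n, ((j : ℕ) + 1) * v j = n
  · simp [h, mul_div_assoc]
  · simp [h, Ne.symm h]

lemma halfBinom_eq_choose {j : ℕ} (hj : j ≠ 0) : halfBinom j = Ring.choose (1 / 2 : ℝ) j := by
  rw [halfBinom, if_neg hj, Ring.choose_eq_smul, ← descPochhammer_eval_eq_prod_range,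
    ← descPochhammer_map (Int.castRingHom ℝ), Polynomial.eval_map, smul_eq_mul, div_eq_inv_mul,
    ← Polynomial.eval₂_smulOneHom_eq_smeval]
  congr 2
  exact Subsingleton.elim _ _

open PowerSeries in
/-- `(1 + X) ^ (1 / 2)` times twice its derivative is `1`. -/
lemma binomialSeries_half_mul_two_derivative :
    PowerSeries.binomialSeries ℝ (1 / 2 : ℝ) *
      (2 * derivative ℝ (PowerSeries.binomialSeries ℝ (1 / 2 : ℝ))) = 1 := by
  have hsq : PowerSeries.binomialSeries ℝ (1 / 2 : ℝ) * PowerSeries.binomialSeries ℝ (1 / 2 : ℝ) =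
      1 + X := by
    rw [← binomialSeries_add, show (1 / 2 + 1 / 2 : ℝ) = ((1 : ℕ) : ℝ) by norm_num,
      binomialSeries_nat, pow_one]
  have hD := congrArg (derivative ℝ) hsq
  rw [Derivation.leibniz, map_add, derivative_one, derivative_X, zero_add, smul_eq_mul] at hD
  rw [← hD]
  ring

open PowerSeries in
/-- The inverse `B` of a power series agrees up to degree `n` with the truncated geometric series
`∑ k ≤ n, (-A) ^ k` as soon as `1 + A` agrees with the series up to degree `n`. -/
lemma coeff_geom_sum_neg_eq_of_mul_eq_one {R : Type*} [CommRing R] {S A B : PowerSeries R} {n : ℕ}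
    (hSB : S * B = 1) (hA : X ∣ A) (hS : X ^ (n + 1) ∣ S - (1 + A)) :
    coeff n (∑ k ∈ Finset.range (n + 1), (-A) ^ k) = coeff n B := by
  set G := ∑ k ∈ Finset.range (n + 1), (-A) ^ k with hG
  have hgeom : (1 + A) * G = 1 - (-A) ^ (n + 1) := by
    rw [hG, ← mul_neg_geom_sum, sub_neg_eq_add]
  have hdvd : X ^ (n + 1) ∣ G - B := by
    have heq : G - B = B * ((S - (1 + A)) * G - (-A) ^ (n + 1)) := by
      linear_combination (-G) * hSB + B * hgeom
    rw [heq]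
    exact ((hS.mul_right G).sub (pow_dvd_pow_of_dvd (hA.neg_right) _)).mul_left B
  exact sub_eq_zero.mp (by simpa using X_pow_dvd_iff.mp hdvd n n.lt_succ_self)

/-- **One-dimensional magic identity.** -/
theorem one_dimensional_magic_identity (n : ℕ) (hn : 1 ≤ n) :
    (∑ k ∈ Finset.Icc 1 n,
      ∑ᶠ v ∈ Pnk n k,
        ((-1 : ℝ) ^ k * (k.factorial : ℝ) / ∏ j : Fin n, ((v j).factorial : ℝ)) *
          ∏ j : Fin n, (halfBinom ((j : ℕ) + 1)) ^ (v j))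
      = 2 * ((n : ℝ) + 1) * halfBinom (n + 1) := by
  simp_rw [finsum_Pnk_eq_coeff_pow]
  set A : PowerSeries ℝ := ∑ j : Fin n, PowerSeries.C (halfBinom ((j : ℕ) + 1)) *
    PowerSeries.X ^ ((j : ℕ) + 1) with hA
  have hXA : PowerSeries.X ∣ A :=
    Finset.dvd_sum fun j _ => (dvd_pow_self _ (Nat.succ_ne_zero _)).mul_left _
  have hS : PowerSeries.X ^ (n + 1) ∣ PowerSeries.binomialSeries ℝ (1 / 2 : ℝ) - (1 + A) := by
    refine PowerSeries.X_pow_dvd_iff.mpr fun m hm => ?_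
    rcases m with _ | m
    · simp [hA]
    · have hcoeff : PowerSeries.coeff (m + 1) A = halfBinom (m + 1) := by
        rw [hA, map_sum, Finset.sum_eq_single (⟨m, by lia⟩ : Fin n)]
        · simp [PowerSeries.coeff_X_pow]
        · intro j _ hj
          have hne : m ≠ (j : ℕ) := fun h => hj (Fin.ext h.symm)
          simp [PowerSeries.coeff_X_pow, hne]
        · simp
      rw [map_sub, map_add, hcoeff, PowerSeries.binomialSeries_coeff,
        halfBinom_eq_choose (Nat.succ_ne_zero m), PowerSeries.coeff_one]
      simp
  have key := coeff_geom_sum_neg_eq_of_mul_eq_one binomialSeries_half_mul_two_derivative hXA hS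
  rw [Finset.sum_range_succ', map_add, pow_zero, PowerSeries.coeff_one, if_neg (by lia), add_zero,
    map_sum] at key
  rw [← Finset.Ico_add_one_right_eq_Icc, Finset.sum_Ico_eq_sum_range]
  simp only [Nat.add_sub_cancel, add_comm 1]
  rw [key, halfBinom_eq_choose (Nat.succ_ne_zero n), two_mul, map_add,
    PowerSeries.coeff_derivative, PowerSeries.binomialSeries_coeff, smul_eq_mul]
  ring
end

section
/- Let λ ∈ (1, 3/2] and let X : ℝ² → ℝ² be a map satisfying |X(y) − X(z) − (y − z)| ≤ λ·(log λ)·|y − z| for all y, z ∈ ℝ². Then for any points a, b, c ∈ ℝ² with |c − (a+b)/2| ≥ 4|a − b|, and any ρ ∈ [0,1], one has |ρ X(a) + (1−ρ) X(b) − X(c)| ≥ |c − (a+b)/2| / 12. -/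
theorem mul_log_le_two_thirds {x : ℝ} (h1 : 1 < x) (h2 : x ≤ 3 / 2) :
    x * Real.log x ≤ 2 / 3 := by
  have hlog : Real.log x ≤ 4 / 9 := by
    rw [Real.log_le_iff_le_exp (by linarith)]
    have := Real.quadratic_le_exp_of_nonneg (x := 4 / 9) (by norm_num)
    norm_num at this
    linarith
  nlinarith

/-- If the increments of `X` differ from those of the identity by at most `k |y - z|` with
`k ≤ 2 / 3`,
then convex combinations of `X a` and `X b` stay away from `X c` whenever `c` is far from the
midpoint of `a` and `b`. -/
theorem norm_convex_combination_sub_ge {E : Type*} [NormedAddCommGroup E] [NormedSpace ℝ E]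
    {k : ℝ} (hk : k ≤ 2 / 3) {X : E → E}
    (hX : ∀ y z : E, ‖X y - X z - (y - z)‖ ≤ k * ‖y - z‖) (a b c : E) {ρ : ℝ}
    (hρ : ρ ∈ Set.Icc (0 : ℝ) 1) (h : 4 * ‖a - b‖ ≤ ‖c - (2⁻¹ : ℝ) • (a + b)‖) :
    ‖c - (2⁻¹ : ℝ) • (a + b)‖ / 8 ≤ ‖ρ • X a + (1 - ρ) • X b - X c‖ := by
  obtain ⟨h0, h1⟩ := hρ
  set d := ‖c - (2⁻¹ : ℝ) • (a + b)‖ with hd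
  have hac : ‖a - c‖ ≤ 9 / 8 * d := by
    have e : a - c = (2⁻¹ : ℝ) • (a - b) - (c - (2⁻¹ : ℝ) • (a + b)) := by module
    have := norm_sub_le ((2⁻¹ : ℝ) • (a - b)) (c - (2⁻¹ : ℝ) • (a + b))
    rw [← e, norm_smul, Real.norm_of_nonneg (by norm_num)] at this
    linarith
  have hbc : ‖b - c‖ ≤ 9 / 8 * d := by
    have e : b - c = -((2⁻¹ : ℝ) • (a - b)) - (c - (2⁻¹ : ℝ) • (a + b)) := by module
    have := norm_sub_le (-((2⁻¹ : ℝ) • (a - b))) (c - (2⁻¹ : ℝ) • (a + b))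
    rw [← e, norm_neg, norm_smul, Real.norm_of_nonneg (by norm_num)] at this
    linarith
  have herr : ∀ y, ‖y - c‖ ≤ 9 / 8 * d → ‖X y - X c - (y - c)‖ ≤ 3 / 4 * d := fun y hy => by
    nlinarith [hX y c, mul_le_mul_of_nonneg_right hk (norm_nonneg (y - c))]
  have hmid : ‖(ρ - 2⁻¹) • (a - b)‖ ≤ d / 8 := by
    rw [norm_smul, Real.norm_eq_abs]
    have : |ρ - 2⁻¹| ≤ 2⁻¹ := abs_le.2 ⟨by linarith, by linarith⟩
    nlinarith [mul_le_mul_of_nonneg_right this (norm_nonneg (a - b))]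
  have hconv : ‖ρ • (X a - X c - (a - c)) + (1 - ρ) • (X b - X c - (b - c))‖ ≤ 3 / 4 * d := by
    refine (norm_add_le _ _).trans ?_
    rw [norm_smul, norm_smul, Real.norm_of_nonneg h0, Real.norm_of_nonneg (sub_nonneg.2 h1)]
    nlinarith [mul_le_mul_of_nonneg_left (herr a hac) h0,
      mul_le_mul_of_nonneg_left (herr b hbc) (sub_nonneg.2 h1)]
  have e : c - (2⁻¹ : ℝ) • (a + b) = (ρ - 2⁻¹) • (a - b) +
      (ρ • (X a - X c - (a - c)) + (1 - ρ) • (X b - X c - (b - c))) -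
      (ρ • X a + (1 - ρ) • X b - X c) := by module
  have key : d ≤ ‖(ρ - 2⁻¹) • (a - b)‖ +
      ‖ρ • (X a - X c - (a - c)) + (1 - ρ) • (X b - X c - (b - c))‖ +
      ‖ρ • X a + (1 - ρ) • X b - X c‖ := by
    rw [hd, e]
    exact (norm_sub_le _ _).trans (by gcongr; exact norm_add_le _ _)
  linarith

/-- Lower bound for `|ρX(a) + (1−ρ)X(b) − X(c)|` away from the segment, for a
chord-arc-type map `X` on `ℝ²`. -/
theorem convex_combination_lower_bound (lam : ℝ) (hlam1 : 1 < lam) (hlam2 : lam ≤ 3 / 2)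
    (X : EuclideanSpace ℝ (Fin 2) → EuclideanSpace ℝ (Fin 2))
    (hX : ∀ y z : EuclideanSpace ℝ (Fin 2),
      ‖X y - X z - (y - z)‖ ≤ lam * Real.log lam * ‖y - z‖) :
    ∀ a b c : EuclideanSpace ℝ (Fin 2), ∀ ρ : ℝ, ρ ∈ Set.Icc (0 : ℝ) 1 →
      4 * ‖a - b‖ ≤ ‖c - (2⁻¹ : ℝ) • (a + b)‖ →
      ‖c - (2⁻¹ : ℝ) • (a + b)‖ / 12 ≤ ‖ρ • X a + (1 - ρ) • X b - X c‖ := by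
  intro a b c ρ hρ h
  have := norm_convex_combination_sub_ge (mul_log_le_two_thirds hlam1 hlam2) hX a b c hρ h
  linarith [norm_nonneg (c - (2⁻¹ : ℝ) • (a + b))]
end

section
/- Let K_in : ℝ² \ {0} → ℝ² be defined by K_in(y) = (y^⊥ / (2π|y|³)) · e^{−|y|²}, where y^⊥ = (−y₂, y₁). Then for every multi-index α ∈ ℕ₀² and every y ≠ 0, |∂^α K_in(y)| ≤ (2^5)^{|α|} · |α|! · e^{−|y|²/2} / |y|^{|α|+2}. In particular the constant C_K in the bound |∂^α K_in(y)| ≤ C_K^{|α|} |α|! e^{−|y|²/2} / |y|^{|α|+2} can be taken to be at most 2^5. -/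
/-- Euclidean norm on `ℝ²` (represented as `ℝ × ℝ`). -/
noncomputable def nrm (y : ℝ × ℝ) : ℝ := Real.sqrt (y.1 ^ 2 + y.2 ^ 2)

/-- Partial derivative in the first variable. -/
noncomputable def pd1 (f : ℝ × ℝ → ℝ) : ℝ × ℝ → ℝ :=
  fun y => deriv (fun s => f (s, y.2)) y.1

/-- Partial derivative in the second variable. -/
noncomputable def pd2 (f : ℝ × ℝ → ℝ) : ℝ × ℝ → ℝ :=
  fun y => deriv (fun s => f (y.1, s)) y.2

/-- The iterated partial derivative `∂^α = ∂_{y_1}^{α₁} ∂_{y_2}^{α₂}`. -/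
noncomputable def pdMulti (α₁ α₂ : ℕ) (f : ℝ × ℝ → ℝ) : ℝ × ℝ → ℝ :=
  (pd1)^[α₁] ((pd2)^[α₂] f)

/-- First component of `K_in(y) = (y^⊥/(2π|y|³))·e^{−|y|²}`, where `y^⊥ = (−y₂, y₁)`. -/
noncomputable def Kin1 (y : ℝ × ℝ) : ℝ :=
  -y.2 / (2 * Real.pi * nrm y ^ 3) * Real.exp (-(nrm y ^ 2))

/-- Second component of `K_in(y) = (y^⊥/(2π|y|³))·e^{−|y|²}`. -/
noncomputable def Kin2 (y : ℝ × ℝ) : ℝ :=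
  y.1 / (2 * Real.pi * nrm y ^ 3) * Real.exp (-(nrm y ^ 2))

/-- The complexified quadratic form `z₁² + z₂²`. -/
def quadForm (z : ℂ × ℂ) : ℂ := z.1 ^ 2 + z.2 ^ 2

/-- The open set on which the principal branch of `log (z₁² + z₂²)` is holomorphic. -/
def slitDomain : Set (ℂ × ℂ) := {z | quadForm z ∈ Complex.slitPlane}

/-- Complex partial derivative in the first variable. -/
noncomputable def cpd1 (f : ℂ × ℂ → ℂ) : ℂ × ℂ → ℂ :=
  fun z => deriv (fun s => f (s, z.2)) z.1

/-- Complex partial derivative in the second variable. -/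
noncomputable def cpd2 (f : ℂ × ℂ → ℂ) : ℂ × ℂ → ℂ :=
  fun z => deriv (fun s => f (z.1, s)) z.2

/-- Holomorphic extension of the radial factor `e^{-|y|²} / (2π|y|³)`. -/
noncomputable def radialExt (z : ℂ × ℂ) : ℂ :=
  Complex.exp (-(3 / 2) * Complex.log (quadForm z) - quadForm z) / (2 * Real.pi)

/-- The embedding of `ℝ²` into `ℂ²`. -/
def toComplexPair (y : ℝ × ℝ) : ℂ × ℂ := ((y.1 : ℂ), (y.2 : ℂ))

lemma isOpen_slitDomain : IsOpen slitDomain := by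
  refine Complex.isOpen_slitPlane.preimage ?_
  unfold quadForm
  fun_prop

lemma analyticOnNhd_radialExt : AnalyticOnNhd ℂ radialExt slitDomain := by
  intro z hz
  have hq : AnalyticAt ℂ quadForm z :=
    (analyticAt_fst.pow 2).add (analyticAt_snd.pow 2)
  have hl : AnalyticAt ℂ (fun z => Complex.log (quadForm z)) z := hq.clog hz
  exact (((analyticAt_const.mul hl).sub hq).cexp).div_const

lemma hasDerivAt_slice_fst {f : ℂ × ℂ → ℂ} {z : ℂ × ℂ} (hf : AnalyticAt ℂ f z) :
    HasDerivAt (fun s => f (s, z.2)) (fderiv ℂ f z (1, 0)) z.1 := by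
  have h : HasDerivAt (fun s : ℂ => (s, z.2)) ((1 : ℂ), (0 : ℂ)) z.1 :=
    (hasDerivAt_id _).prodMk (hasDerivAt_const _ _)
  exact (hf.differentiableAt.hasFDerivAt (x := (z.1, z.2))).comp_hasDerivAt z.1 h

lemma hasDerivAt_slice_snd {f : ℂ × ℂ → ℂ} {z : ℂ × ℂ} (hf : AnalyticAt ℂ f z) :
    HasDerivAt (fun s => f (z.1, s)) (fderiv ℂ f z (0, 1)) z.2 := by
  have h : HasDerivAt (fun s : ℂ => (z.1, s)) ((0 : ℂ), (1 : ℂ)) z.2 :=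
    (hasDerivAt_const _ _).prodMk (hasDerivAt_id _)
  exact (hf.differentiableAt.hasFDerivAt (x := (z.1, z.2))).comp_hasDerivAt z.2 h

lemma AnalyticOnNhd.cpd1 {f : ℂ × ℂ → ℂ} {U : Set (ℂ × ℂ)} (hU : IsOpen U)
    (hf : AnalyticOnNhd ℂ f U) : AnalyticOnNhd ℂ (cpd1 f) U := by
  have h : AnalyticOnNhd ℂ (fun z => fderiv ℂ f z (1, 0)) U := fun z hz =>
    (ContinuousLinearMap.analyticAt (ContinuousLinearMap.apply ℂ ℂ ((1 : ℂ), (0 : ℂ))) _).comp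
      (hf.fderiv z hz)
  exact h.congr hU fun z hz => (hasDerivAt_slice_fst (hf z hz)).deriv.symm

lemma AnalyticOnNhd.cpd2 {f : ℂ × ℂ → ℂ} {U : Set (ℂ × ℂ)} (hU : IsOpen U)
    (hf : AnalyticOnNhd ℂ f U) : AnalyticOnNhd ℂ (cpd2 f) U := by
  have h : AnalyticOnNhd ℂ (fun z => fderiv ℂ f z (0, 1)) U := fun z hz =>
    (ContinuousLinearMap.analyticAt (ContinuousLinearMap.apply ℂ ℂ ((0 : ℂ), (1 : ℂ))) _).comp
      (hf.fderiv z hz)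
  exact h.congr hU fun z hz => (hasDerivAt_slice_snd (hf z hz)).deriv.symm

lemma AnalyticOnNhd.iterate_cpd2 {f : ℂ × ℂ → ℂ} {U : Set (ℂ × ℂ)} (hU : IsOpen U)
    (hf : AnalyticOnNhd ℂ f U) (n : ℕ) : AnalyticOnNhd ℂ (_root_.cpd2^[n] f) U := by
  induction n with
  | zero => exact hf
  | succ n ih =>
    rw [Function.iterate_succ_apply']
    exact ih.cpd2 hU

lemma AnalyticOnNhd.iterate_cpd1 {f : ℂ × ℂ → ℂ} {U : Set (ℂ × ℂ)} (hU : IsOpen U)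
    (hf : AnalyticOnNhd ℂ f U) (n : ℕ) : AnalyticOnNhd ℂ (_root_.cpd1^[n] f) U := by
  induction n with
  | zero => exact hf
  | succ n ih =>
    rw [Function.iterate_succ_apply']
    exact ih.cpd1 hU

lemma iterate_cpd1_eq (f : ℂ × ℂ → ℂ) (n : ℕ) (z : ℂ × ℂ) :
    cpd1^[n] f z = iteratedDeriv n (fun s => f (s, z.2)) z.1 := by
  induction n generalizing z with
  | zero => simp
  | succ n ih =>
    rw [Function.iterate_succ_apply', iteratedDeriv_succ, cpd1]
    simp only [ih]

lemma iterate_cpd2_eq (f : ℂ × ℂ → ℂ) (n : ℕ) (z : ℂ × ℂ) :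
    cpd2^[n] f z = iteratedDeriv n (fun s => f (z.1, s)) z.2 := by
  induction n generalizing z with
  | zero => simp
  | succ n ih =>
    rw [Function.iterate_succ_apply', iteratedDeriv_succ, cpd2]
    simp only [ih]

lemma nrm_sq (y : ℝ × ℝ) : nrm y ^ 2 = y.1 ^ 2 + y.2 ^ 2 :=
  Real.sq_sqrt (by positivity)

lemma nrm_pos {y : ℝ × ℝ} (hy : y ≠ 0) : 0 < nrm y := by
  refine Real.sqrt_pos.2 ?_
  by_contra! h
  exact hy (Prod.ext (by simp; nlinarith [sq_nonneg y.1, sq_nonneg y.2])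
    (by simp; nlinarith [sq_nonneg y.1, sq_nonneg y.2]))

lemma quadForm_toComplexPair (y : ℝ × ℝ) : quadForm (toComplexPair y) = ((nrm y ^ 2 : ℝ) : ℂ) := by
  simp [nrm_sq, quadForm, toComplexPair]

lemma toComplexPair_mem_slitDomain {y : ℝ × ℝ} (hy : y ≠ 0) : toComplexPair y ∈ slitDomain := by
  have := nrm_pos hy
  rw [slitDomain, Set.mem_ofPred_eq, quadForm_toComplexPair, Complex.ofReal_mem_slitPlane]
  positivity

/-- If `g` agrees away from the origin with the real part of a holomorphic `G`, so do the
first partial derivatives. -/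
lemma pd1_eq_re_cpd1 {g : ℝ × ℝ → ℝ} {G : ℂ × ℂ → ℂ} (hG : AnalyticOnNhd ℂ G slitDomain)
    (h : ∀ y : ℝ × ℝ, y ≠ 0 → g y = (G (toComplexPair y)).re) (y : ℝ × ℝ) (hy : y ≠ 0) :
    pd1 g y = (cpd1 G (toComplexPair y)).re := by
  have hd := hasDerivAt_slice_fst (hG _ (toComplexPair_mem_slitDomain hy))
  have hr := HasDerivAt.real_of_complex (z := y.1) hd
  have hev : (fun s : ℝ => g (s, y.2)) =ᶠ[nhds y.1]
      fun s : ℝ => (G ((s : ℂ), (toComplexPair y).2)).re := by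
    have hc : ContinuousAt (fun s : ℝ => (s, y.2)) y.1 := by fun_prop
    filter_upwards [hc.eventually_ne (y := (0 : ℝ × ℝ)) hy] with s hs using h (s, y.2) hs
  rw [pd1, hev.deriv_eq, hr.deriv, cpd1, hd.deriv]

lemma pd2_eq_re_cpd2 {g : ℝ × ℝ → ℝ} {G : ℂ × ℂ → ℂ} (hG : AnalyticOnNhd ℂ G slitDomain)
    (h : ∀ y : ℝ × ℝ, y ≠ 0 → g y = (G (toComplexPair y)).re) (y : ℝ × ℝ) (hy : y ≠ 0) :
    pd2 g y = (cpd2 G (toComplexPair y)).re := by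
  have hd := hasDerivAt_slice_snd (hG _ (toComplexPair_mem_slitDomain hy))
  have hr := HasDerivAt.real_of_complex (z := y.2) hd
  have hev : (fun s : ℝ => g (y.1, s)) =ᶠ[nhds y.2]
      fun s : ℝ => (G ((toComplexPair y).1, (s : ℂ))).re := by
    have hc : ContinuousAt (fun s : ℝ => (y.1, s)) y.2 := by fun_prop
    filter_upwards [hc.eventually_ne (y := (0 : ℝ × ℝ)) hy] with s hs using h (y.1, s) hs
  rw [pd2, hev.deriv_eq, hr.deriv, cpd2, hd.deriv]

lemma pdMulti_eq_re {g : ℝ × ℝ → ℝ} {G : ℂ × ℂ → ℂ} (hG : AnalyticOnNhd ℂ G slitDomain)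
    (h : ∀ y : ℝ × ℝ, y ≠ 0 → g y = (G (toComplexPair y)).re) (a b : ℕ) :
    ∀ y : ℝ × ℝ, y ≠ 0 → pdMulti a b g y = (cpd1^[a] (cpd2^[b] G) (toComplexPair y)).re := by
  have h2 : ∀ y : ℝ × ℝ, y ≠ 0 → pd2^[b] g y = (cpd2^[b] G (toComplexPair y)).re := by
    induction b with
    | zero => exact h
    | succ b ih =>
      simp only [Function.iterate_succ_apply']
      exact pd2_eq_re_cpd2 (hG.iterate_cpd2 isOpen_slitDomain b) ih
  unfold pdMulti
  induction a with
  | zero => exact h2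
  | succ a ih =>
    simp only [Function.iterate_succ_apply']
    exact pd1_eq_re_cpd1
      ((hG.iterate_cpd2 isOpen_slitDomain b).iterate_cpd1 isOpen_slitDomain a) ih

/-- Cauchy estimate for mixed derivatives on a polydisc with equal radii. -/
lemma norm_iterate_cpd_le {G : ℂ × ℂ → ℂ} {U : Set (ℂ × ℂ)} (hU : IsOpen U)
    (hG : AnalyticOnNhd ℂ G U) (c : ℂ × ℂ) {r M : ℝ} (hr : 0 < r)
    (hsub : ∀ z : ℂ × ℂ, ‖z.1 - c.1‖ ≤ r → ‖z.2 - c.2‖ ≤ r → z ∈ U)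
    (hM : ∀ z : ℂ × ℂ, ‖z.1 - c.1‖ ≤ r → ‖z.2 - c.2‖ ≤ r → ‖G z‖ ≤ M) (a b : ℕ) :
    ‖cpd1^[a] (cpd2^[b] G) c‖ ≤ a.factorial * (b.factorial * M / r ^ b) / r ^ a := by
  rw [iterate_cpd1_eq]
  refine Complex.norm_iteratedDeriv_le_of_forall_mem_sphere_norm_le a hr ?_ ?_
  · refine DifferentiableOn.diffContOnCl_ball (U := Metric.closedBall c.1 r) ?_ subset_rfl
    intro s hs
    have hs' : (s, c.2) ∈ U := hsub (s, c.2) (mem_closedBall_iff_norm.1 hs) (by simp [hr.le])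
    exact (hasDerivAt_slice_fst
      (hG.iterate_cpd2 hU b _ hs')).differentiableAt.differentiableWithinAt
  · intro s hs
    have hs1 : ‖s - c.1‖ ≤ r := (mem_sphere_iff_norm.1 hs).le
    rw [iterate_cpd2_eq]
    refine Complex.norm_iteratedDeriv_le_of_forall_mem_sphere_norm_le b hr ?_ ?_
    · refine DifferentiableOn.diffContOnCl_ball (U := Metric.closedBall c.2 r) ?_ subset_rfl
      intro t ht
      have ht' : (s, t) ∈ U := hsub (s, t) hs1 (mem_closedBall_iff_norm.1 ht)
      exact (hasDerivAt_slice_snd (hG _ ht')).differentiableAt.differentiableWithinAt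
    · intro t ht
      exact hM (s, t) hs1 (mem_sphere_iff_norm.1 ht).le

lemma exp_log_sq {N : ℝ} (hN : 0 < N) :
    Real.exp (-(3 / 2) * Real.log (N ^ 2)) = (N ^ 3)⁻¹ := by
  rw [Real.log_pow, ← Real.exp_log (inv_pos.2 (pow_pos hN 3)), Real.log_inv, Real.log_pow]
  push_cast
  ring_nf

lemma radialExt_toComplexPair {y : ℝ × ℝ} (hy : y ≠ 0) :
    radialExt (toComplexPair y) =
      ((1 / (2 * Real.pi * nrm y ^ 3) * Real.exp (-(nrm y ^ 2)) : ℝ) : ℂ) := by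
  have hN := nrm_pos hy
  have h : Real.exp (-(3 / 2) * Real.log (nrm y ^ 2) - nrm y ^ 2) / (2 * Real.pi) =
      1 / (2 * Real.pi * nrm y ^ 3) * Real.exp (-(nrm y ^ 2)) := by
    rw [sub_eq_add_neg, Real.exp_add, exp_log_sq hN]
    field_simp
  rw [radialExt, quadForm_toComplexPair, ← Complex.ofReal_log (by positivity), ← h]
  push_cast
  rfl

lemma norm_quadForm_sub_le {N r : ℝ} {y : ℝ × ℝ} (hN : nrm y = N) (hr : N / 32 = r) {z : ℂ × ℂ}
    (h1 : ‖z.1 - y.1‖ ≤ r) (h2 : ‖z.2 - y.2‖ ≤ r) :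
    ‖quadForm z - ((N ^ 2 : ℝ) : ℂ)‖ ≤ 9 / 25 * N ^ 2 := by
  have hN0 : 0 ≤ N := hN ▸ Real.sqrt_nonneg _
  have hy1 : |y.1| ≤ N := hN ▸ Real.abs_le_sqrt (by nlinarith [sq_nonneg y.2])
  have hy2 : |y.2| ≤ N := hN ▸ Real.abs_le_sqrt (by nlinarith [sq_nonneg y.1])
  have key : ∀ (t : ℝ) (w : ℂ), |t| ≤ N → ‖w - t‖ ≤ r →
      ‖w ^ 2 - (t : ℂ) ^ 2‖ ≤ 9 / 50 * N ^ 2 := by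
    intro t w ht hw
    have e : w ^ 2 - (t : ℂ) ^ 2 = (w - t) * (w - t) + 2 * t * (w - t) := by ring
    have n1 := norm_add_le ((w - t) * (w - t)) (2 * t * (w - t))
    simp only [norm_mul, Complex.norm_real, Real.norm_eq_abs, Complex.norm_ofNat] at n1
    rw [e]
    have := mul_le_mul hw hw (norm_nonneg _) ((norm_nonneg _).trans hw)
    have := mul_le_mul ht hw (norm_nonneg _) hN0
    subst hr
    nlinarith
  have e : quadForm z - ((N ^ 2 : ℝ) : ℂ) =
      (z.1 ^ 2 - (y.1 : ℂ) ^ 2) + (z.2 ^ 2 - (y.2 : ℂ) ^ 2) := by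
    rw [← hN, nrm_sq, quadForm]
    push_cast
    ring
  rw [e]
  linarith [norm_add_le (z.1 ^ 2 - (y.1 : ℂ) ^ 2) (z.2 ^ 2 - (y.2 : ℂ) ^ 2),
    key _ _ hy1 h1, key _ _ hy2 h2]

lemma le_re_of_norm_sub_le {N : ℝ} {w : ℂ}
    (h : ‖w - ((N ^ 2 : ℝ) : ℂ)‖ ≤ 9 / 25 * N ^ 2) : (4 / 5 * N) ^ 2 ≤ w.re := by
  have := (abs_le.1 ((Complex.abs_re_le_norm _).trans h)).1
  rw [Complex.sub_re, Complex.ofReal_re] at this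
  linarith

lemma norm_radialExt_le {N : ℝ} (hN : 0 < N) {z : ℂ × ℂ} (h : (4 / 5 * N) ^ 2 ≤ (quadForm z).re) :
    ‖radialExt z‖ ≤ 125 / (384 * N ^ 3) * Real.exp (-(N ^ 2) / 2) := by
  have hq : (4 / 5 * N) ^ 2 ≤ ‖quadForm z‖ := h.trans (Complex.re_le_norm _)
  have hlog : Real.log ((4 / 5 * N) ^ 2) ≤ Real.log ‖quadForm z‖ :=
    Real.log_le_log (by positivity) hq
  have hpi := Real.pi_gt_three
  have hexp : Real.exp (-(3 / 2) * Real.log ‖quadForm z‖ - (quadForm z).re) ≤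
      ((4 / 5 * N) ^ 3)⁻¹ * Real.exp (-(N ^ 2) / 2) := by
    rw [← exp_log_sq (by positivity), ← Real.exp_add]
    refine Real.exp_le_exp.2 ?_
    nlinarith [sq_nonneg N]
  have hn : ‖radialExt z‖ =
      Real.exp (-(3 / 2) * Real.log ‖quadForm z‖ - (quadForm z).re) / (2 * Real.pi) := by
    have e : (-(3 / 2) * Complex.log (quadForm z) - quadForm z).re =
        -(3 / 2) * Real.log ‖quadForm z‖ - (quadForm z).re := by
      have : (-(3 / 2) : ℂ) = ((-(3 / 2) : ℝ) : ℂ) := by push_cast; rfl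
      rw [this, Complex.sub_re, Complex.re_ofReal_mul, Complex.log_re]
    rw [radialExt, norm_div, Complex.norm_exp, e, norm_mul, Complex.norm_ofNat,
      Complex.norm_real, Real.norm_eq_abs, abs_of_pos Real.pi_pos]
  rw [hn]
  calc _ ≤ ((4 / 5 * N) ^ 3)⁻¹ * Real.exp (-(N ^ 2) / 2) / (2 * 3) := by gcongr
    _ = _ := by field_simp; norm_num

/-- Derivative bound for a real function extending holomorphically as a coordinate-sized
factor times the radial factor. -/
lemma abs_pdMulti_le {g : ℝ × ℝ → ℝ} {L : ℂ × ℂ → ℂ} (hL : AnalyticOnNhd ℂ L slitDomain)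
    (h : ∀ y : ℝ × ℝ, y ≠ 0 → g y = (L (toComplexPair y) * radialExt (toComplexPair y)).re)
    (hLn : ∀ z, ‖L z‖ ≤ max ‖z.1‖ ‖z.2‖) (a b : ℕ) (y : ℝ × ℝ) (hy : y ≠ 0) :
    |pdMulti a b g y| ≤ ((2 : ℝ) ^ 5) ^ (a + b) * ((a + b).factorial : ℝ) *
        Real.exp (-(nrm y ^ 2) / 2) / nrm y ^ (a + b + 2) / 2 := by
  have hN := nrm_pos hy
  have hG : AnalyticOnNhd ℂ (fun z => L z * radialExt z) slitDomain :=
    hL.mul analyticOnNhd_radialExt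
  rw [pdMulti_eq_re hG h a b y hy]
  have hre : ∀ z : ℂ × ℂ, ‖z.1 - (toComplexPair y).1‖ ≤ nrm y / 32 →
      ‖z.2 - (toComplexPair y).2‖ ≤ nrm y / 32 → (4 / 5 * nrm y) ^ 2 ≤ (quadForm z).re :=
    fun z h1 h2 => le_re_of_norm_sub_le (norm_quadForm_sub_le rfl rfl h1 h2)
  have hcoord : ∀ (t : ℝ) (w : ℂ), |t| ≤ nrm y → ‖w - t‖ ≤ nrm y / 32 →
      ‖w‖ ≤ 33 / 32 * nrm y := by
    intro t w ht hw
    have := norm_add_le (w - t) (t : ℂ)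
    rw [sub_add_cancel, Complex.norm_real, Real.norm_eq_abs] at this
    linarith
  have hc := norm_iterate_cpd_le isOpen_slitDomain hG (toComplexPair y) (r := nrm y / 32)
    (M := Real.exp (-(nrm y ^ 2) / 2) / (2 * nrm y ^ 2)) (by positivity)
    (fun z h1 h2 => Or.inl (lt_of_lt_of_le (by positivity) (hre z h1 h2)))
    (fun z h1 h2 => by
      have hz1 := hcoord y.1 z.1 (Real.abs_le_sqrt (by nlinarith [sq_nonneg y.2])) h1
      have hz2 := hcoord y.2 z.2 (Real.abs_le_sqrt (by nlinarith [sq_nonneg y.1])) h2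
      calc ‖L z * radialExt z‖ = ‖L z‖ * ‖radialExt z‖ := norm_mul _ _
        _ ≤ (33 / 32 * nrm y) * (125 / (384 * nrm y ^ 3) * Real.exp (-(nrm y ^ 2) / 2)) :=
          mul_le_mul ((hLn z).trans (max_le hz1 hz2)) (norm_radialExt_le hN (hre z h1 h2))
            (norm_nonneg _) (by positivity)
        _ = (33 * 125 / (32 * 192)) * (Real.exp (-(nrm y ^ 2) / 2) / (2 * nrm y ^ 2)) := by
          field_simp; norm_num
        _ ≤ 1 * (Real.exp (-(nrm y ^ 2) / 2) / (2 * nrm y ^ 2)) := by gcongr; norm_num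
        _ = _ := one_mul _) a b
  refine ((Complex.abs_re_le_norm _).trans hc).trans ?_
  have hf : (a.factorial * b.factorial : ℝ) ≤ (a + b).factorial := by
    exact_mod_cast Nat.le_of_dvd (Nat.factorial_pos _)
      (Nat.factorial_mul_factorial_dvd_factorial_add a b)
  calc _ = ((2 : ℝ) ^ 5) ^ (a + b) * (a.factorial * b.factorial : ℝ) *
        Real.exp (-(nrm y ^ 2) / 2) / nrm y ^ (a + b + 2) / 2 := by
        rw [div_pow, div_pow, pow_add, pow_add, pow_add]
        norm_num
        field_simp
    _ ≤ _ := by gcongr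

/-- Gaussian-weighted derivative bounds for the localized SQG kernel `K_in`, with the
explicit constant `C_K = 2^5`. -/
theorem Kin_derivative_bounds (α₁ α₂ : ℕ) (y : ℝ × ℝ) (hy : y ≠ 0) :
    Real.sqrt ((pdMulti α₁ α₂ Kin1 y) ^ 2 + (pdMulti α₁ α₂ Kin2 y) ^ 2) ≤
      ((2 : ℝ) ^ 5) ^ (α₁ + α₂) * ((α₁ + α₂).factorial : ℝ) *
        Real.exp (-(nrm y ^ 2) / 2) / nrm y ^ (α₁ + α₂ + 2) := by
  have hN := nrm_pos hy
  have h1 := abs_pdMulti_le (g := Kin1) (L := fun z => -z.2) analyticOnNhd_snd.neg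
    (fun y hy => by
      rw [radialExt_toComplexPair hy, toComplexPair, ← Complex.ofReal_neg, ← Complex.ofReal_mul,
        Complex.ofReal_re, Kin1]
      ring) (fun z => by simp) α₁ α₂ y hy
  have h2 := abs_pdMulti_le (g := Kin2) (L := fun z => z.1) analyticOnNhd_fst
    (fun y hy => by
      rw [radialExt_toComplexPair hy, toComplexPair, ← Complex.ofReal_mul,
        Complex.ofReal_re, Kin2]
      ring) (fun z => by simp) α₁ α₂ y hy
  set B := ((2 : ℝ) ^ 5) ^ (α₁ + α₂) * ((α₁ + α₂).factorial : ℝ) *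
    Real.exp (-(nrm y ^ 2) / 2) / nrm y ^ (α₁ + α₂ + 2)
  have hB : 0 ≤ B := by positivity
  refine Real.sqrt_le_iff.2 ⟨hB, ?_⟩
  have s1 := sq_le_sq' (abs_le.1 h1).1 (abs_le.1 h1).2
  have s2 := sq_le_sq' (abs_le.1 h2).1 (abs_le.1 h2).2
  nlinarith [sq_nonneg B]
end
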